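/- arXiv:2508.12203 — 11 statements merged into one kernel-verified Lean document; each statement's English description precedes it below -/
import Mathlib

section
/- Let u₁, u₂, u₃ be 2×2 complex matrices with tr(u₁) = tr(u₂) = tr(u₃) = 0. Then u₁, u₂, u₃ are linearly dependent over ℂ (as elements of the vector space of 2×2 complex matrices) if and only if tr(u₁u₂u₃) = 0. -/
/-- Trace-zero 2×2 complex matrices `u₁, u₂, u₃` are linearly dependent
over ℂ iff `tr(u₁u₂u₃) = 0`. -/
theorem trace_zero_linearDependent_iff (u₁ u₂ u₃ : Matrix (Fin 2) (Fin 2) ℂ)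
    (h₁ : u₁.trace = 0) (h₂ : u₂.trace = 0) (h₃ : u₃.trace = 0) :
    ¬ LinearIndependent ℂ ![u₁, u₂, u₃] ↔ (u₁ * u₂ * u₃).trace = 0 := by
  rw [Matrix.trace_fin_two] at h₁ h₂ h₃
  have e₁ : u₁ 1 1 = - u₁ 0 0 := by linear_combination h₁
  have e₂ : u₂ 1 1 = - u₂ 0 0 := by linear_combination h₂
  have e₃ : u₃ 1 1 = - u₃ 0 0 := by linear_combination h₃
  let M : Matrix (Fin 3) (Fin 3) ℂ :=
    !![u₁ 0 0, u₁ 0 1, u₁ 1 0; u₂ 0 0, u₂ 0 1, u₂ 1 0; u₃ 0 0, u₃ 0 1, u₃ 1 0]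
  have hdet : (u₁ * u₂ * u₃).trace = M.det := by
    simp only [M, Matrix.det_fin_three, Matrix.trace_fin_two, Matrix.mul_apply, Fin.sum_univ_two,
      e₁, e₂, e₃]
    simp
    ring
  rw [hdet, ← Matrix.exists_vecMul_eq_zero_iff, Fintype.not_linearIndependent_iff]
  refine exists_congr fun g => ?_
  rw [and_comm]
  refine and_congr Function.ne_iff.symm ?_
  simp only [Fin.sum_univ_three, ← Matrix.ext_iff, funext_iff, Fin.forall_fin_two,
    Fin.forall_fin_succ, M, Matrix.vecMul, dotProduct]
  simp [e₁, e₂, e₃]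
  constructor
  · rintro ⟨⟨a, b⟩, c, d⟩
    exact ⟨a, b, c⟩
  · rintro ⟨a, b, c⟩
    exact ⟨⟨a, b⟩, c, by linear_combination -a⟩
end

section
/- Let t ∈ ℂ and let x, y ∈ SL(2,ℂ) with tr(x) = tr(y) = t. Then the following are equivalent: (i) tr(xy) ∉ {2, t² − 2}; (ii) the pair (x, y) is irreducible; (iii) the matrices I, x, y, xy span the full 4-dimensional space of 2×2 complex matrices over ℂ. -/
open Matrix

/-- A family of 2×2 complex matrices is irreducible if there is no nonzero vector
`v ∈ ℂ²` which is a common eigenvector of all members. -/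
def IsIrreducibleFamily {ι : Type*} (x : ι → Matrix (Fin 2) (Fin 2) ℂ) : Prop :=
  ¬ ∃ v : Fin 2 → ℂ, v ≠ 0 ∧ ∀ i, ∃ a : ℂ, (x i).mulVec v = a • v

/-- The wedge of `M v` with `v`. -/
def wedgeForm (M : Matrix (Fin 2) (Fin 2) ℂ) (v : Fin 2 → ℂ) : ℂ :=
  M 1 0 * v 0 ^ 2 + (M 1 1 - M 0 0) * v 0 * v 1 - M 0 1 * v 1 ^ 2

/-- Negative determinant of the commutator. -/
def commForm (x y : Matrix (Fin 2) (Fin 2) ℂ) : ℂ :=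
  (x 0 1 * y 1 0 - x 1 0 * y 0 1) ^ 2 +
    ((x 0 0 - x 1 1) * y 0 1 - (y 0 0 - y 1 1) * x 0 1) *
    (x 1 0 * (y 0 0 - y 1 1) - (x 0 0 - x 1 1) * y 1 0)

lemma ne_zero_cases {v : Fin 2 → ℂ} (hv : v ≠ 0) : v 0 ≠ 0 ∨ v 1 ≠ 0 := by
  by_contra! h
  apply hv
  ext i
  fin_cases i
  · exact h.1
  · exact h.2

lemma eigen_iff (M : Matrix (Fin 2) (Fin 2) ℂ) {v : Fin 2 → ℂ} (hv : v ≠ 0) :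
    (∃ a : ℂ, M.mulVec v = a • v) ↔ wedgeForm M v = 0 := by
  constructor
  · rintro ⟨a, h⟩
    have h0 := congrFun h 0
    have h1 := congrFun h 1
    simp [Matrix.mulVec, dotProduct, Fin.sum_univ_two] at h0 h1
    unfold wedgeForm
    linear_combination v 0 * h1 - v 1 * h0
  · intro h
    unfold wedgeForm at h
    rcases ne_zero_cases hv with h0 | h0
    · refine ⟨(M 0 0 * v 0 + M 0 1 * v 1) / v 0, ?_⟩
      ext i
      fin_cases i
      · simp [Matrix.mulVec, dotProduct, Fin.sum_univ_two]
        field_simp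
      · simp [Matrix.mulVec, dotProduct, Fin.sum_univ_two]
        field_simp
        linear_combination h
    · refine ⟨(M 1 0 * v 0 + M 1 1 * v 1) / v 1, ?_⟩
      ext i
      fin_cases i
      · simp [Matrix.mulVec, dotProduct, Fin.sum_univ_two]
        field_simp
        linear_combination -h
      · simp [Matrix.mulVec, dotProduct, Fin.sum_univ_two]
        field_simp

lemma exists_wedge (M : Matrix (Fin 2) (Fin 2) ℂ) : ∃ v, v ≠ 0 ∧ wedgeForm M v = 0 := by
  obtain ⟨μ, hμ⟩ := Module.End.exists_eigenvalue (Matrix.toLin' M)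
  obtain ⟨v, hv⟩ := hμ.exists_hasEigenvector
  refine ⟨v, hv.2, (eigen_iff M hv.2).1 ⟨μ, ?_⟩⟩
  simpa using hv.apply_eq_smul

lemma irred_iff_wedge (x y : Matrix (Fin 2) (Fin 2) ℂ) :
    IsIrreducibleFamily ![x, y] ↔ ¬ ∃ v, v ≠ 0 ∧ wedgeForm x v = 0 ∧ wedgeForm y v = 0 := by
  unfold IsIrreducibleFamily
  refine not_congr (exists_congr fun v => and_congr_right fun hv => ?_)
  rw [Fin.forall_fin_two, ← eigen_iff x hv, ← eigen_iff y hv]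
  rfl

lemma wedge_iff (x y : Matrix (Fin 2) (Fin 2) ℂ) :
    (∃ v, v ≠ 0 ∧ wedgeForm x v = 0 ∧ wedgeForm y v = 0) ↔ commForm x y = 0 := by
  constructor
  · rintro ⟨v, hv, hx, hy⟩
    unfold wedgeForm at hx hy
    unfold commForm
    -- the commutator kills `v`
    set p := x 0 1 * y 1 0 - x 1 0 * y 0 1 with hp
    set q := (x 0 0 - x 1 1) * y 0 1 - (y 0 0 - y 1 1) * x 0 1 with hq
    set r := x 1 0 * (y 0 0 - y 1 1) - (x 0 0 - x 1 1) * y 1 0 with hr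
    have e0 : v 0 * (p * v 0 + q * v 1) = 0 := by
      rw [hp, hq]
      linear_combination x 0 1 * hy - y 0 1 * hx
    have e1 : v 1 * (p * v 0 + q * v 1) = 0 := by
      rw [hp, hq]
      grind
    have f0 : v 0 * (r * v 0 - p * v 1) = 0 := by
      rw [hp, hr]
      grind
    have f1 : v 1 * (r * v 0 - p * v 1) = 0 := by
      rw [hp, hr]
      linear_combination y 1 0 * hx - x 1 0 * hy
    rcases ne_zero_cases hv with h0 | h0
    · have e := (mul_eq_zero.1 e0).resolve_left h0
      have f := (mul_eq_zero.1 f0).resolve_left h0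
      refine (mul_eq_zero.1 (?_ : v 0 * _ = 0)).resolve_left h0
      linear_combination p * e + q * f
    · have e := (mul_eq_zero.1 e1).resolve_left h0
      have f := (mul_eq_zero.1 f1).resolve_left h0
      refine (mul_eq_zero.1 (?_ : v 1 * _ = 0)).resolve_left h0
      linear_combination r * e - p * f
  · intro hK
    unfold commForm at hK
    by_cases h1 : (![x 0 1 * y 1 0 - x 1 0 * y 0 1,
        x 1 0 * (y 0 0 - y 1 1) - (x 0 0 - x 1 1) * y 1 0] : Fin 2 → ℂ) = 0
    · by_cases h2 : (![(x 0 0 - x 1 1) * y 0 1 - (y 0 0 - y 1 1) * x 0 1,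
          -(x 0 1 * y 1 0 - x 1 0 * y 0 1)] : Fin 2 → ℂ) = 0
      · have hp := congrFun h1 0
        have hr := congrFun h1 1
        have hq := congrFun h2 0
        simp at hp hr hq
        by_cases hs : x 0 1 = 0 ∧ x 1 0 = 0 ∧ x 0 0 - x 1 1 = 0
        · obtain ⟨v, hv, hyv⟩ := exists_wedge y
          refine ⟨v, hv, ?_, hyv⟩
          unfold wedgeForm
          linear_combination v 0 ^ 2 * hs.2.1 - v 0 * v 1 * hs.2.2 - v 1 ^ 2 * hs.1
        · obtain ⟨v, hv, hxv⟩ := exists_wedge x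
          refine ⟨v, hv, hxv, ?_⟩
          unfold wedgeForm at hxv ⊢
          by_contra hne
          apply hs
          refine ⟨?_, ?_, ?_⟩
          · refine mul_right_cancel₀ hne ?_
            linear_combination y 0 1 * hxv + v 0 ^ 2 * hp + v 0 * v 1 * hq
          · refine mul_right_cancel₀ hne ?_
            linear_combination y 1 0 * hxv + v 1 ^ 2 * hp - v 0 * v 1 * hr
          · refine mul_right_cancel₀ hne ?_
            linear_combination (y 0 0 - y 1 1) * hxv - v 1 ^ 2 * hq - v 0 ^ 2 * hr
      · refine ⟨_, h2, ?_, ?_⟩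
        · simp [wedgeForm]
          linear_combination (-x 0 1) * hK
        · simp [wedgeForm]
          linear_combination (-y 0 1) * hK
    · refine ⟨_, h1, ?_, ?_⟩
      · simp [wedgeForm]
        linear_combination (x 1 0) * hK
      · simp [wedgeForm]
        linear_combination (y 1 0) * hK

lemma span_iff (x y : Matrix (Fin 2) (Fin 2) ℂ) :
    Submodule.span ℂ {1, x, y, x * y} = ⊤ ↔ commForm x y ≠ 0 := by
  constructor
  · intro h hK
    obtain ⟨v, hv, hx, hy⟩ := (wedge_iff x y).2 hK
    have key : ∀ M : Matrix (Fin 2) (Fin 2) ℂ, wedgeForm M v = 0 := by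
      intro M
      have hM : M ∈ Submodule.span ℂ {1, x, y, x * y} := by rw [h]; trivial
      induction hM using Submodule.span_induction with
      | mem z hz =>
        rcases hz with rfl | rfl | rfl | rfl
        · simp [wedgeForm]
        · exact hx
        · exact hy
        · obtain ⟨a, ha⟩ := (eigen_iff x hv).2 hx
          obtain ⟨b, hb⟩ := (eigen_iff y hv).2 hy
          refine (eigen_iff _ hv).1 ⟨b * a, ?_⟩
          rw [← Matrix.mulVec_mulVec, hb, Matrix.mulVec_smul, ha, smul_smul]
      | zero => simp [wedgeForm]
      | add A B _ _ hA hB =>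
        simp only [wedgeForm, Matrix.add_apply] at *
        linear_combination hA + hB
      | smul c A _ hA =>
        simp only [wedgeForm, Matrix.smul_apply, smul_eq_mul] at *
        linear_combination c * hA
    have k1 := key !![0, 0; 1, 0]
    have k2 := key !![0, 1; 0, 0]
    simp [wedgeForm] at k1 k2
    rcases ne_zero_cases hv with h0 | h0
    · exact h0 k1
    · exact h0 k2
  · intro hK
    rw [eq_top_iff]
    rintro M -
    set S := Submodule.span ℂ {1, x, y, x * y} with hS
    have m1 : (1 : Matrix (Fin 2) (Fin 2) ℂ) ∈ S := Submodule.subset_span (by simp)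
    have m2 : x ∈ S := Submodule.subset_span (by simp)
    have m3 : y ∈ S := Submodule.subset_span (by simp)
    have m4 : x * y ∈ S := Submodule.subset_span (by simp)
    have main : ∃ α β γ δ : ℂ, commForm x y • M =
        α • (1 : Matrix (Fin 2) (Fin 2) ℂ) + β • x + γ • y + δ • (x * y) := by
      let C := x * y - y * x
      let δ := (C * M).trace / 2
      let β := (M * (y * C - C * y)).trace / 2
      let γ := (M * (C * x - x * C)).trace / 2
      let α := (commForm x y * M.trace - β * x.trace - γ * y.trace) / 2
      refine ⟨α - δ * ((x * y).trace - x.trace * y.trace), β - δ * y.trace,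
        γ - δ * x.trace, 2 * δ, ?_⟩
      ext i j
      fin_cases i <;> fin_cases j <;>
        simp [α, β, γ, δ, C, commForm, Matrix.trace, Matrix.mul_apply, Fin.sum_univ_two] <;> ring
    obtain ⟨α, β, γ, δ, h⟩ := main
    rw [← Submodule.smul_mem_iff S hK, h]
    exact S.add_mem (S.add_mem (S.add_mem (S.smul_mem _ m1) (S.smul_mem _ m2))
      (S.smul_mem _ m3)) (S.smul_mem _ m4)

/-- For `x, y ∈ SL(2,ℂ)` with `tr x = tr y = t`, the following are
equivalent: (i) `tr(xy) ∉ {2, t² − 2}`; (ii) the pair `(x,y)` is irreducible;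
(iii) `I, x, y, xy` span the space of 2×2 complex matrices. -/
theorem sl2_pair_irreducible_tfae (t : ℂ) (x y : Matrix.SpecialLinearGroup (Fin 2) ℂ)
    (hx : (x : Matrix (Fin 2) (Fin 2) ℂ).trace = t)
    (hy : (y : Matrix (Fin 2) (Fin 2) ℂ).trace = t) :
    ((((x : Matrix (Fin 2) (Fin 2) ℂ) * y).trace ≠ 2 ∧
        ((x : Matrix (Fin 2) (Fin 2) ℂ) * y).trace ≠ t ^ 2 - 2) ↔
      IsIrreducibleFamily ![(x : Matrix (Fin 2) (Fin 2) ℂ), y]) ∧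
    (IsIrreducibleFamily ![(x : Matrix (Fin 2) (Fin 2) ℂ), y] ↔
      Submodule.span ℂ {(1 : Matrix (Fin 2) (Fin 2) ℂ), (x : Matrix (Fin 2) (Fin 2) ℂ),
        (y : Matrix (Fin 2) (Fin 2) ℂ), (x : Matrix (Fin 2) (Fin 2) ℂ) * y} = ⊤) := by
  have hK : commForm (x : Matrix (Fin 2) (Fin 2) ℂ) y =
      (((x : Matrix (Fin 2) (Fin 2) ℂ) * y).trace - 2) *
      (((x : Matrix (Fin 2) (Fin 2) ℂ) * y).trace - (t ^ 2 - 2)) := by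
    have dx := x.det_coe
    have dy := y.det_coe
    generalize (x : Matrix (Fin 2) (Fin 2) ℂ) = X at *
    generalize (y : Matrix (Fin 2) (Fin 2) ℂ) = Y at *
    rw [Matrix.det_fin_two] at dx dy
    simp only [Matrix.trace, Matrix.diag, Matrix.mul_apply, Fin.sum_univ_two] at *
    unfold commForm
    grind
  rw [span_iff, irred_iff_wedge, wedge_iff]
  refine ⟨?_, Iff.rfl⟩
  simp only [hK, ne_eq, mul_eq_zero, sub_eq_zero, not_or]
end

section
/- Let t ∈ ℂ and s₀ = t²/2 − 2. Suppose given complex numbers s_{ij} for 1 ≤ i, j ≤ 3 with s_{ij} = s_{ji}, s_{ii} = s₀ for i = 1,2,3, and a complex number s₁₂₃ ≠ 0 such that 2·s₁₂₃² + det((s_{ij})_{i,j=1}^{3}) = 0. Then there exists a triple (x₁, x₂, x₃) ∈ G(t)³ with tr(x̌ᵢx̌ⱼ) = s_{ij} for all 1 ≤ i, j ≤ 3 and tr(x̌₁x̌₂x̌₃) = s₁₂₃; moreover, any two such triples are simultaneously conjugate, i.e. if (y₁, y₂, y₃) ∈ G(t)³ also satisfies these equations then there exists a ∈ SL(2,ℂ)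 with yᵢ = a·xᵢ·a⁻¹ for i = 1,2,3. -/
open Matrix

/-- `x̌ = x − (tr x / 2)·I`, the trace-free part of a 2×2 matrix. -/
noncomputable def chk (x : Matrix (Fin 2) (Fin 2) ℂ) : Matrix (Fin 2) (Fin 2) ℂ :=
  x - (x.trace / 2) • 1

/-- The quadratic form of a matrix. -/
noncomputable def auxQ (M : Matrix (Fin 3) (Fin 3) ℂ) : QuadraticForm ℂ (Fin 3 → ℂ) :=
  LinearMap.BilinMap.toQuadraticMap (Matrix.toLinearMap₂' ℂ M)

lemma aux_gram (S : Matrix (Fin 3) (Fin 3) ℂ) (hS : ∀ i j, S i j = S j i) (hd : S.det ≠ 0) :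
    ∃ v : Fin 3 → Fin 3 → ℂ, ∀ i j,
      2 * v i 0 * v j 0 + v i 1 * v j 2 + v i 2 * v j 1 = S i j := by
  have key : ∀ M : Matrix (Fin 3) (Fin 3) ℂ, (∀ i j, M i j = M j i) →
      QuadraticMap.associated (R := ℂ) (auxQ M) = Matrix.toLinearMap₂' ℂ M := by
    intro M hM
    rw [auxQ]
    refine QuadraticMap.associated_left_inverse (S := ℂ) (fun x y => ?_)
    simp only [Matrix.toLinearMap₂'_apply, Fin.sum_univ_three, smul_eq_mul]
    rw [hM 1 0, hM 2 0, hM 2 1]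
    ring
  let K : Matrix (Fin 3) (Fin 3) ℂ := !![2,0,0;0,0,1;0,1,0]
  have hK : ∀ i j, K i j = K j i := by
    intro i j
    fin_cases i <;> fin_cases j <;> simp [K]
  have hKd : K.det ≠ 0 := by simp [K, Matrix.det_fin_three]
  obtain ⟨e⟩ := QuadraticForm.equivalent_of_isAlgClosed
    (auxQ S)
    (auxQ K)
    (by rw [key S hS]; exact LinearMap.separatingLeft_toLinearMap₂'_iff_det_ne_zero.2 hd)
    (by rw [key K hK]; exact LinearMap.separatingLeft_toLinearMap₂'_iff_det_ne_zero.2 hKd)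
  refine ⟨fun i => e (Pi.single i 1), fun i j => ?_⟩
  have h1 : ∀ x y, Matrix.toLinearMap₂' ℂ K (e x) (e y) = Matrix.toLinearMap₂' ℂ S x y := by
    intro x y
    rw [← key K hK, ← key S hS]
    simp only [QuadraticMap.associated_apply]
    rw [← map_add, e.map_app, e.map_app, e.map_app]
  have h2 := h1 (Pi.single i 1) (Pi.single j 1)
  have h3 : Matrix.toLinearMap₂' ℂ S (Pi.single i (1 : ℂ)) (Pi.single j (1 : ℂ)) = S i j := by
    simp [Matrix.toLinearMap₂'_apply, Pi.single_apply]
  refine Eq.trans ?_ (h2.trans h3)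
  simp [Matrix.toLinearMap₂'_apply, Fin.sum_univ_three, K]
  ring

lemma aux_form (X : Matrix (Fin 2) (Fin 2) ℂ) (h : X.trace = 0) :
    X = !![X 0 0, X 0 1; X 1 0, - X 0 0] := by
  rw [Matrix.trace_fin_two] at h
  ext i j
  fin_cases i <;> fin_cases j <;> simp
  linear_combination h

lemma aux_eps (i j k : Fin 3) : ∃ e : ℂ, ∀ X : Fin 3 → Matrix (Fin 2) (Fin 2) ℂ,
    (∀ i, (X i).trace = 0) → (X i * X j * X k).trace = e * (X 0 * X 1 * X 2).trace := by
  have key : ∀ e : ℂ, (∀ a b c : Fin 3 → ℂ,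
      (!![a i, b i; c i, - a i] * !![a j, b j; c j, - a j] * !![a k, b k; c k, - a k]).trace
      = e * (!![a 0, b 0; c 0, - a 0] * !![a 1, b 1; c 1, - a 1] * !![a 2, b 2; c 2, - a 2]).trace)
      → ∃ e : ℂ, ∀ X : Fin 3 → Matrix (Fin 2) (Fin 2) ℂ,
    (∀ i, (X i).trace = 0) → (X i * X j * X k).trace = e * (X 0 * X 1 * X 2).trace := by
    intro e he
    refine ⟨e, fun X hX => ?_⟩
    rw [aux_form (X i) (hX i), aux_form (X j) (hX j), aux_form (X k) (hX k),
      aux_form (X 0) (hX 0), aux_form (X 1) (hX 1), aux_form (X 2) (hX 2)]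
    exact he (fun i => X i 0 0) (fun i => X i 0 1) (fun i => X i 1 0)
  simp only [Matrix.trace_fin_two, Matrix.mul_fin_two, Matrix.of_apply, Matrix.cons_val',
    Matrix.cons_val_zero, Matrix.cons_val_one, Matrix.cons_val_fin_one] at key ⊢
  fin_cases i <;> fin_cases j <;> fin_cases k <;>
  first
  | (apply key 0; intro a b c; dsimp; ring1)
  | (apply key 1; intro a b c; dsimp; ring1)
  | (apply key (-1); intro a b c; dsimp; ring1)

lemma aux_det (X : Fin 3 → Matrix (Fin 2) (Fin 2) ℂ) (hX : ∀ i, (X i).trace = 0) :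
    2 * (X 0 * X 1 * X 2).trace ^ 2
      + (Matrix.of fun i j => (X i * X j).trace).det = 0 := by
  have h : ∀ i, X i 1 1 = - X i 0 0 := by
    intro i
    have := hX i
    rw [Matrix.trace_fin_two] at this
    linear_combination this
  simp only [Matrix.det_fin_three, Matrix.of_apply, Matrix.trace_fin_two, Matrix.mul_apply,
    Fin.sum_univ_two, h]
  ring

/-- The family `1, X₀, X₁, X₂`. -/
def auxFam (X : Fin 3 → Matrix (Fin 2) (Fin 2) ℂ) : Option (Fin 3) → Matrix (Fin 2) (Fin 2) ℂ
  | none => 1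
  | some i => X i

lemma aux_li (X : Fin 3 → Matrix (Fin 2) (Fin 2) ℂ) (hX : ∀ i, (X i).trace = 0)
    (hd : (Matrix.of fun i j => (X i * X j).trace).det ≠ 0) :
    LinearIndependent ℂ (auxFam X) := by
  rw [Fintype.linearIndependent_iff]
  intro g hg
  simp only [Fintype.sum_option, auxFam] at hg
  have h0 : g none = 0 := by
    have := congrArg Matrix.trace hg
    simpa [Matrix.trace_sum, hX] using this
  have h1 : (fun i => g (some i)) = 0 := by
    apply Matrix.eq_zero_of_vecMul_eq_zero hd
    ext j
    have := congrArg (fun A => (A * X j).trace) hg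
    simpa [Matrix.trace_sum, hX, h0, Finset.sum_mul, Matrix.vecMul, dotProduct] using this
  rintro (_ | i)
  · exact h0
  · exact congrFun h1 i

lemma aux_tr (X : Fin 3 → Matrix (Fin 2) (Fin 2) ℂ) (hX : ∀ i, (X i).trace = 0)
    (Y : Fin 3 → Matrix (Fin 2) (Fin 2) ℂ) (hY : ∀ i, (Y i).trace = 0)
    (h2 : ∀ i j, (X i * X j).trace = (Y i * Y j).trace)
    (h3 : (X 0 * X 1 * X 2).trace = (Y 0 * Y 1 * Y 2).trace) (i j k : Option (Fin 3)) :
    (auxFam X i * auxFam X j * auxFam X k).trace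
      = (auxFam Y i * auxFam Y j * auxFam Y k).trace := by
  rcases i with _ | i <;> rcases j with _ | j <;> rcases k with _ | k <;>
    simp [auxFam, hX, hY, h2]
  obtain ⟨e, he⟩ := aux_eps i j k
  rw [he X hX, he Y hY, h3]

lemma aux_inner (φ : Matrix (Fin 2) (Fin 2) ℂ ≃ₐ[ℂ] Matrix (Fin 2) (Fin 2) ℂ) :
    ∃ a : Matrix.SpecialLinearGroup (Fin 2) ℂ, ∀ A, φ A * a = a * A := by
  let f := (Matrix.toLinAlgEquiv' (R := ℂ) (n := Fin 2)).symm.trans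
    (φ.trans (Matrix.toLinAlgEquiv' (R := ℂ) (n := Fin 2)))
  obtain ⟨T, hT⟩ := AlgEquiv.eq_linearEquivConjAlgEquiv f
  let M : Matrix (Fin 2) (Fin 2) ℂ := LinearMap.toMatrixAlgEquiv' T.toLinearMap
  have hM : ∀ A, φ A * M = M * A := by
    intro A
    apply (Matrix.toLinAlgEquiv' (R := ℂ) (n := Fin 2)).injective
    have h := congrArg (fun g => g (Matrix.toLinAlgEquiv' A)) hT
    simp only [f, AlgEquiv.trans_apply, AlgEquiv.symm_apply_apply,
      LinearEquiv.conjAlgEquiv_apply] at h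
    rw [map_mul, map_mul, h]
    simp only [M, Matrix.toLinAlgEquiv'_toMatrixAlgEquiv']
    ext x
    simp
  have hMd : M.det ≠ 0 := by
    have h1 : M * LinearMap.toMatrixAlgEquiv' T.symm.toLinearMap = 1 := by
      rw [← map_mul]
      convert map_one (LinearMap.toMatrixAlgEquiv' (R := ℂ) (n := Fin 2)) using 2
      ext x
      simp
    intro h0
    have := congrArg Matrix.det h1
    simp [h0] at this
  obtain ⟨r, hr⟩ := IsAlgClosed.exists_pow_nat_eq M.det (n := 2) (by norm_num)
  have hr0 : r ≠ 0 := by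
    rintro rfl
    apply hMd
    rw [← hr]; simp
  refine ⟨⟨r⁻¹ • M, ?_⟩, fun A => ?_⟩
  · rw [Matrix.det_smul, ← hr]
    simp [hr0]
  · simp [hM]

lemma aux_unique (X : Fin 3 → Matrix (Fin 2) (Fin 2) ℂ) (hX : ∀ i, (X i).trace = 0)
    (Y : Fin 3 → Matrix (Fin 2) (Fin 2) ℂ) (hY : ∀ i, (Y i).trace = 0)
    (h2 : ∀ i j, (X i * X j).trace = (Y i * Y j).trace)
    (h3 : (X 0 * X 1 * X 2).trace = (Y 0 * Y 1 * Y 2).trace)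
    (hd : (Matrix.of fun i j => (X i * X j).trace).det ≠ 0) :
    ∃ a : Matrix.SpecialLinearGroup (Fin 2) ℂ, ∀ i, Y i * a = a * X i := by
  have hd' : (Matrix.of fun i j => (Y i * Y j).trace).det ≠ 0 := by
    simpa only [h2] using hd
  have hc : Fintype.card (Option (Fin 3)) = Module.finrank ℂ (Matrix (Fin 2) (Fin 2) ℂ) := by
    simp [Module.finrank_matrix]
  let bX := basisOfLinearIndependentOfCardEqFinrank (aux_li X hX hd) hc
  let bY := basisOfLinearIndependentOfCardEqFinrank (aux_li Y hY hd') hc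
  have hbX : ∀ i, bX i = auxFam X i := fun i => by simp [bX]
  have hbY : ∀ i, bY i = auxFam Y i := fun i => by simp [bY]
  let l := bX.equiv bY (Equiv.refl _)
  have hl : ∀ i, l (auxFam X i) = auxFam Y i := by
    intro i
    rw [← hbX, ← hbY]
    simp [l]
  have h3' := aux_tr X hX Y hY h2 h3
  let τ : Matrix (Fin 2) (Fin 2) ℂ →ₗ[ℂ] Matrix (Fin 2) (Fin 2) ℂ →ₗ[ℂ] ℂ :=
    (LinearMap.mul ℂ (Matrix (Fin 2) (Fin 2) ℂ)).compr₂ (Matrix.traceLinearMap (Fin 2) ℂ ℂ)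
  have hτ : ∀ A B, τ A B = (A * B).trace := fun A B => rfl
  have hpres : ∀ A B, (l A * l B).trace = (A * B).trace := by
    have : (τ.compl₁₂ l.toLinearMap l.toLinearMap) = τ := by
      apply LinearMap.ext_basis bX bX
      intro i j
      rw [LinearMap.compl₁₂_apply, hbX, hbX, hτ]
      simp only [LinearEquiv.coe_coe, hl, hτ]
      simpa [auxFam] using (h3' i j none).symm
    intro A B
    exact LinearMap.congr_fun₂ this A B
  have hnd : ∀ A B : Matrix (Fin 2) (Fin 2) ℂ,
      (∀ k, (A * auxFam Y k).trace = (B * auxFam Y k).trace) → A = B := by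
    intro A B h
    have : τ A = τ B := by
      apply bY.ext
      intro k
      rw [hτ, hτ, hbY, h]
    ext i j
    have := LinearMap.congr_fun this (Matrix.single j i 1)
    simpa [hτ, Matrix.trace_mul_single] using this
  have hmul : ∀ A B, l (A * B) = l A * l B := by
    have : (LinearMap.mul ℂ (Matrix (Fin 2) (Fin 2) ℂ)).compr₂ l.toLinearMap
        = (LinearMap.mul ℂ (Matrix (Fin 2) (Fin 2) ℂ)).compl₁₂ l.toLinearMap l.toLinearMap := by
      apply LinearMap.ext_basis bX bX
      intro i j
      simp only [LinearMap.compr₂_apply, LinearMap.compl₁₂_apply, LinearMap.mul_apply',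
        LinearEquiv.coe_coe, hbX, hl]
      apply hnd
      intro k
      rw [← h3', ← hl k, hpres]
    intro A B
    exact LinearMap.congr_fun₂ this A B
  obtain ⟨a, ha⟩ := aux_inner (AlgEquiv.ofLinearEquiv l (hl none) hmul)
  refine ⟨a, fun i => ?_⟩
  rw [← ha (X i)]
  congr 1
  exact (hl (some i)).symm

lemma aux_chk_trace (x : Matrix (Fin 2) (Fin 2) ℂ) : (chk x).trace = 0 := by
  simp [chk]

lemma aux_exists (S : Matrix (Fin 3) (Fin 3) ℂ) (hS : ∀ i j, S i j = S j i) (r : ℂ) (hr : r ≠ 0)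
    (hd : 2 * r ^ 2 + S.det = 0) :
    ∃ X : Fin 3 → Matrix (Fin 2) (Fin 2) ℂ, (∀ i, (X i).trace = 0) ∧
      (∀ i j, (X i * X j).trace = S i j) ∧ (X 0 * X 1 * X 2).trace = r := by
  have hd0 : S.det ≠ 0 := by
    intro h
    rw [h] at hd
    simp [hr] at hd
  obtain ⟨v, hv⟩ := aux_gram S hS hd0
  let X : Fin 3 → Matrix (Fin 2) (Fin 2) ℂ := fun i => !![v i 0, v i 1; v i 2, - v i 0]
  have hX : ∀ i, (X i).trace = 0 := fun i => by simp [X, Matrix.trace_fin_two]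
  have hX2 : ∀ i j, (X i * X j).trace = S i j := by
    intro i j
    rw [← hv]
    simp [X, Matrix.trace_fin_two]
    ring
  have h := aux_det X hX
  have hSe : (Matrix.of fun i j => (X i * X j).trace) = S := by
    ext i j; simp [hX2]
  rw [hSe] at h
  have h4 : (X 0 * X 1 * X 2).trace ^ 2 = r ^ 2 := by linear_combination (h - hd) / 2
  rcases sq_eq_sq_iff_eq_or_eq_neg.1 h4 with h5 | h5
  · exact ⟨X, hX, hX2, h5⟩
  · refine ⟨fun i => - X i, fun i => by simp [hX], fun i j => by simp [hX2], ?_⟩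
    simp [h5]

/-- Given a symmetric matrix `(sᵢⱼ)` with diagonal entries `s₀ = t²/2 − 2`
and `s₁₂₃ ≠ 0` with `2s₁₂₃² + det (sᵢⱼ) = 0`, there is a triple
`(x₁,x₂,x₃) ∈ G(t)³` realizing these data, unique up to simultaneous conjugation. -/
theorem exists_triple_realizing_traces (t : ℂ) (s : Fin 3 → Fin 3 → ℂ) (s₁₂₃ : ℂ)
    (hsymm : ∀ i j, s i j = s j i)
    (hdiag : ∀ i, s i i = t ^ 2 / 2 - 2)
    (hne : s₁₂₃ ≠ 0)
    (hdet : 2 * s₁₂₃ ^ 2 + (Matrix.of s).det = 0) :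
    ∃ x : Fin 3 → Matrix.SpecialLinearGroup (Fin 2) ℂ,
      (∀ i, ((x i : Matrix (Fin 2) (Fin 2) ℂ)).trace = t) ∧
      (∀ i j, (chk (x i : Matrix (Fin 2) (Fin 2) ℂ) *
          chk (x j : Matrix (Fin 2) (Fin 2) ℂ)).trace = s i j) ∧
      (chk (x 0 : Matrix (Fin 2) (Fin 2) ℂ) * chk (x 1 : Matrix (Fin 2) (Fin 2) ℂ) *
          chk (x 2 : Matrix (Fin 2) (Fin 2) ℂ)).trace = s₁₂₃ ∧
      ∀ y : Fin 3 → Matrix.SpecialLinearGroup (Fin 2) ℂ,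
        (∀ i, ((y i : Matrix (Fin 2) (Fin 2) ℂ)).trace = t) →
        (∀ i j, (chk (y i : Matrix (Fin 2) (Fin 2) ℂ) *
            chk (y j : Matrix (Fin 2) (Fin 2) ℂ)).trace = s i j) →
        (chk (y 0 : Matrix (Fin 2) (Fin 2) ℂ) * chk (y 1 : Matrix (Fin 2) (Fin 2) ℂ) *
            chk (y 2 : Matrix (Fin 2) (Fin 2) ℂ)).trace = s₁₂₃ →
        ∃ a : Matrix.SpecialLinearGroup (Fin 2) ℂ, ∀ i, y i = a * x i * a⁻¹ := by

  obtain ⟨X, hX, hX2, hX3⟩ := aux_exists (Matrix.of s) hsymm s₁₂₃ hne hdet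
  have hxdet : ∀ i, (X i + (t / 2) • (1 : Matrix (Fin 2) (Fin 2) ℂ)).det = 1 := by
    intro i
    have h1 := hX2 i i
    have h0 := hX i
    rw [Matrix.of_apply, hdiag, Matrix.trace_fin_two] at h1
    rw [Matrix.trace_fin_two] at h0
    simp only [Matrix.mul_apply, Fin.sum_univ_two] at h1
    simp [Matrix.det_fin_two]
    linear_combination (-1 / 2) * h1 + (X i 0 0 + X i 1 1 + t) / 2 * h0
  have htr : ∀ i, (X i + (t / 2) • (1 : Matrix (Fin 2) (Fin 2) ℂ)).trace = t := by
    intro i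
    simp [hX]
  have hchk : ∀ i, chk (X i + (t / 2) • (1 : Matrix (Fin 2) (Fin 2) ℂ)) = X i := by
    intro i
    rw [chk, htr]
    simp
  refine ⟨fun i => ⟨_, hxdet i⟩, htr, ?_, ?_, ?_⟩
  · intro i j
    simp only [hchk]
    exact hX2 i j
  · simp only [hchk]
    exact hX3
  · intro y hy hy2 hy3
    obtain ⟨a, ha⟩ := aux_unique X hX (fun i => chk (y i)) (fun i => aux_chk_trace _)
      (fun i j => by rw [hX2, hy2]; rfl) (by rw [hX3, hy3]) (by
        have hSe : (Matrix.of fun i j => (X i * X j).trace) = Matrix.of s := by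
          ext i j; rw [Matrix.of_apply, hX2]
        rw [hSe]
        intro h
        rw [h] at hdet
        simp [hne] at hdet)
    refine ⟨a, fun i => ?_⟩
    rw [eq_mul_inv_iff_mul_eq]
    apply Subtype.ext
    have h := ha i
    simp only [chk, hy] at h
    change (y i : Matrix (Fin 2) (Fin 2) ℂ) * a.1 = a.1 * (X i + (t / 2) • 1)
    rw [mul_add, ← h, sub_mul]
    simp
end

section
/- Let t ∈ ℂ, s₀ = t²/2 − 2, and ε ∈ {1, −1}. Suppose (x₁, x₂, x₃) ∈ G(t)³ is irreducible, tr(x̌₁x̌₂x̌₃) = 0, and tr(x̌₁x̌₃) = ε·s₀. Then x₁x₃ = x₃x₁. Furthermore, if t ≠ 2 and t ≠ −2, then x₃ = x₁ when ε = 1, and x₃ = x₁⁻¹ when ε = −1. -/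
open Matrix

local notation "𝕄" => Matrix (Fin 2) (Fin 2) ℂ
local notation "SL2" => Matrix.SpecialLinearGroup (Fin 2) ℂ

lemma key_aux (a b c p q r u v w l m n : ℂ)
    (hA : l * a + m * b + n * c = 0) (hC : l * p + m * q + n * r = 0)
    (hdet : a * (v * r - w * q) - b * (u * r - w * p) + c * (u * q - v * p) = 0)
    (hn : ¬ (a * q - b * p = 0 ∧ a * r - c * p = 0 ∧ b * r - c * q = 0)) :
    l * u + m * v + n * w = 0 := by
  by_contra h
  apply hn
  refine ⟨?_, ?_, ?_⟩ <;> apply (mul_eq_zero.mp ?_).resolve_right h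
  · linear_combination (u * q - v * p) * hA + (a * v - b * u) * hC - n * hdet
  · linear_combination (u * r - w * p) * hA + (a * w - c * u) * hC + m * hdet
  · linear_combination (v * r - w * q) * hA + (b * w - c * v) * hC - l * hdet

lemma key (a b c p q r u v w ε : ℂ) (hε : ε = 1 ∨ ε = -1)
    (hs : a ^ 2 + b * c = p ^ 2 + q * r)
    (h13 : 2 * a * p + b * r + c * q = ε * (2 * (a ^ 2 + b * c)))
    (hdet : a * (v * r - w * q) - b * (u * r - w * p) + c * (u * q - v * p) = 0)
    (hn : ¬ (a * q - b * p = 0 ∧ a * r - c * p = 0 ∧ b * r - c * q = 0)) :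
    ∃ y z : ℂ, (y ≠ 0 ∨ z ≠ 0) ∧ 2 * y * z * a + z ^ 2 * b + (-y ^ 2) * c = 0 ∧
      2 * y * z * p + z ^ 2 * q + (-y ^ 2) * r = 0 ∧
      2 * y * z * u + z ^ 2 * v + (-y ^ 2) * w = 0 := by
  have he : ε ^ 2 = 1 := by rcases hε with h | h <;> rw [h] <;> norm_num
  obtain ⟨d, hd⟩ : ∃ d, d = p - ε * a := ⟨_, rfl⟩
  obtain ⟨e, hee⟩ : ∃ e, e = q - ε * b := ⟨_, rfl⟩
  obtain ⟨f, hf⟩ : ∃ f, f = r - ε * c := ⟨_, rfl⟩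
  have hp : p = d + ε * a := by rw [hd]; ring
  have hq : q = e + ε * b := by rw [hee]; ring
  have hr : r = f + ε * c := by rw [hf]; ring
  have hDA : 2 * a * d + b * f + c * e = 0 := by
    rw [hd, hee, hf]; linear_combination h13
  have hDD : d ^ 2 + e * f = 0 := by
    rw [hd, hee, hf]; linear_combination -(a ^ 2 + b * c) * he - hs - ε * h13
  by_cases e0 : e = 0
  · have d0 : d = 0 := by simpa [e0] using hDD
    have hf0 : f ≠ 0 := by
      intro f0
      apply hn
      rw [hp, hq, hr, d0, e0, f0]
      refine ⟨?_, ?_, ?_⟩ <;> ring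
    have hb : b = 0 := by simpa [d0, e0, hf0] using hDA
    have hA : 2 * 0 * 1 * a + (1:ℂ) ^ 2 * b + (-(0:ℂ) ^ 2) * c = 0 := by rw [hb]; ring
    have hC : 2 * 0 * 1 * p + (1:ℂ) ^ 2 * q + (-(0:ℂ) ^ 2) * r = 0 := by
      rw [hq, e0, hb]; ring
    exact ⟨0, 1, Or.inr one_ne_zero, hA, hC, key_aux a b c p q r u v w _ _ _ hA hC hdet hn⟩
  · have hA : 2 * e * (-d) * a + (-d) ^ 2 * b + (-e ^ 2) * c = 0 := by
      linear_combination b * hDD - e * hDA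
    have hC : 2 * e * (-d) * p + (-d) ^ 2 * q + (-e ^ 2) * r = 0 := by
      rw [hp, hq, hr]
      linear_combination ε * hA - e * hDD
    exact ⟨e, -d, Or.inl e0, hA, hC, key_aux a b c p q r u v w _ _ _ hA hC hdet hn⟩

lemma eig (M : Matrix (Fin 2) (Fin 2) ℂ) (y z : ℂ) (h0 : y ≠ 0 ∨ z ≠ 0)
    (h : 2 * y * z * ((M 0 0 - M 1 1) / 2) + z ^ 2 * M 0 1 + (-y ^ 2) * M 1 0 = 0) :
    ∃ a : ℂ, M.mulVec ![y, z] = a • ![y, z] := by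
  by_cases hy : y = 0
  · have hz : z ≠ 0 := by tauto
    refine ⟨(M 1 0 * y + M 1 1 * z) / z, ?_⟩
    ext i
    fin_cases i <;> simp [Matrix.mulVec, dotProduct, Fin.sum_univ_two]
    · field_simp
      linear_combination h
    · field_simp
  · refine ⟨(M 0 0 * y + M 0 1 * z) / y, ?_⟩
    ext i
    fin_cases i <;> simp [Matrix.mulVec, dotProduct, Fin.sum_univ_two]
    · field_simp
    · field_simp
      linear_combination -h

/-- If `(x₁,x₂,x₃) ∈ G(t)³` is irreducible with `tr(x̌₁x̌₂x̌₃) = 0` and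
`tr(x̌₁x̌₃) = ε·s₀` where `s₀ = t²/2 − 2` and `ε = ±1`, then `x₁` and `x₃` commute;
moreover if `t ≠ ±2` then `x₃ = x₁` when `ε = 1` and `x₃ = x₁⁻¹` when `ε = −1`. -/
theorem commute_of_s13_eq (t ε : ℂ) (hε : ε = 1 ∨ ε = -1)
    (x₁ x₂ x₃ : SL2)
    (hx₁ : ((x₁ : 𝕄)).trace = t) (hx₂ : ((x₂ : 𝕄)).trace = t) (hx₃ : ((x₃ : 𝕄)).trace = t)
    (hirr : IsIrreducibleFamily ![(x₁ : 𝕄), (x₂ : 𝕄), (x₃ : 𝕄)])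
    (h123 : (chk (x₁ : 𝕄) * chk (x₂ : 𝕄) * chk (x₃ : 𝕄)).trace = 0)
    (h13 : (chk (x₁ : 𝕄) * chk (x₃ : 𝕄)).trace = ε * (t ^ 2 / 2 - 2)) :
    x₁ * x₃ = x₃ * x₁ ∧
    (t ≠ 2 → t ≠ -2 → (ε = 1 → x₃ = x₁) ∧ (ε = -1 → x₃ = x₁⁻¹)) := by
  have d1 := x₁.det_coe
  have d3 := x₃.det_coe
  rw [Matrix.det_fin_two] at d1 d3
  simp only [chk, hx₁, hx₂, hx₃] at h123 h13
  simp only [Matrix.trace_fin_two, Matrix.mul_apply, Fin.sum_univ_two, Matrix.sub_apply,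
    Matrix.smul_apply, Matrix.one_apply_eq, smul_eq_mul, mul_one, ne_eq, one_ne_zero,
    zero_ne_one, not_false_eq_true, Matrix.one_apply_ne, mul_zero, sub_zero]
    at hx₁ hx₂ hx₃ h123 h13
  have ex1 : (x₁ : 𝕄) = !![x₁ 0 0, x₁ 0 1; x₁ 1 0, x₁ 1 1] := Matrix.eta_fin_two _
  have ex3 : (x₃ : 𝕄) = !![x₃ 0 0, x₃ 0 1; x₃ 1 0, x₃ 1 1] := Matrix.eta_fin_two _
  obtain ⟨a, ha⟩ : ∃ a, a = ((x₁ : 𝕄) 0 0 - (x₁ : 𝕄) 1 1) / 2 := ⟨_, rfl⟩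
  obtain ⟨u, hu⟩ : ∃ a, a = ((x₂ : 𝕄) 0 0 - (x₂ : 𝕄) 1 1) / 2 := ⟨_, rfl⟩
  obtain ⟨p, hp⟩ : ∃ a, a = ((x₃ : 𝕄) 0 0 - (x₃ : 𝕄) 1 1) / 2 := ⟨_, rfl⟩
  have a0 : (x₁ : 𝕄) 0 0 = t / 2 + a := by rw [ha, ← hx₁]; ring
  have a1 : (x₁ : 𝕄) 1 1 = t / 2 - a := by rw [ha, ← hx₁]; ring
  have u0 : (x₂ : 𝕄) 0 0 = t / 2 + u := by rw [hu, ← hx₂]; ring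
  have u1 : (x₂ : 𝕄) 1 1 = t / 2 - u := by rw [hu, ← hx₂]; ring
  have p0 : (x₃ : 𝕄) 0 0 = t / 2 + p := by rw [hp, ← hx₃]; ring
  have p1 : (x₃ : 𝕄) 1 1 = t / 2 - p := by rw [hp, ← hx₃]; ring
  have hcross : a * (x₃ : 𝕄) 0 1 - (x₁ : 𝕄) 0 1 * p = 0 ∧ a * (x₃ : 𝕄) 1 0 - (x₁ : 𝕄) 1 0 * p = 0 ∧
      (x₁ : 𝕄) 0 1 * (x₃ : 𝕄) 1 0 - (x₁ : 𝕄) 1 0 * (x₃ : 𝕄) 0 1 = 0 := by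
    by_contra hn
    rw [a0, a1] at d1 h13 h123
    rw [p0, p1] at d3 h13 h123
    rw [u0, u1] at h123
    obtain ⟨y, z, h0, hA, hC, hB⟩ := key a _ _ p _ _ u ((x₂ : 𝕄) 0 1) ((x₂ : 𝕄) 1 0) ε hε
      (by linear_combination d3 - d1) (by linear_combination h13 + 2 * ε * d1)
      (by linear_combination h123) hn
    apply hirr
    refine ⟨![y, z], ?_, ?_⟩
    · intro h
      have h1 := congrFun h 0
      have h2 := congrFun h 1
      simp at h1 h2
      tauto
    · rw [ha] at hA
      rw [hu] at hB
      rw [hp] at hC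
      intro i
      fin_cases i
      · exact eig _ y z h0 hA
      · exact eig _ y z h0 hB
      · exact eig _ y z h0 hC
  obtain ⟨c1, c2, c3⟩ := hcross
  have d1' := d1
  have h13' := h13
  rw [a0, a1] at d1' h13'
  rw [p0, p1] at h13'
  constructor
  · apply Subtype.ext
    ext i j
    fin_cases i <;> fin_cases j <;>
      simp [Matrix.mul_apply, Fin.sum_univ_two, a0, a1, p0, p1]
    · linear_combination c3
    · linear_combination 2 * c1
    · linear_combination -2 * c2
    · linear_combination -c3
  · intro t2 t2'
    have hs : t ^ 2 / 4 - 1 ≠ 0 := by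
      intro h
      have : (t - 2) * (t + 2) = 0 := by linear_combination 4 * h
      rcases mul_eq_zero.mp this with h | h
      · exact t2 (by linear_combination h)
      · exact t2' (by linear_combination h)
    have hP : p = ε * a := by
      apply mul_right_cancel₀ hs
      linear_combination p * d1' + a / 2 * h13' - (x₁ : 𝕄) 0 1 / 2 * c2 - (x₁ : 𝕄) 1 0 / 2 * c1
    have hQ : (x₃ : 𝕄) 0 1 = ε * (x₁ : 𝕄) 0 1 := by
      apply mul_right_cancel₀ hs
      linear_combination (x₃ : 𝕄) 0 1 * d1' + (x₁ : 𝕄) 0 1 / 2 * h13' + a * c1 - (x₁ : 𝕄) 0 1 / 2 * c3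
    have hR : (x₃ : 𝕄) 1 0 = ε * (x₁ : 𝕄) 1 0 := by
      apply mul_right_cancel₀ hs
      linear_combination (x₃ : 𝕄) 1 0 * d1' + (x₁ : 𝕄) 1 0 / 2 * h13' + a * c2 + (x₁ : 𝕄) 1 0 / 2 * c3
    constructor
    · intro e
      apply Subtype.ext
      ext i j
      fin_cases i <;> fin_cases j <;> simp [a0, a1, p0, p1, hP, hQ, hR, e]
    · intro e
      apply Subtype.ext
      rw [Matrix.SpecialLinearGroup.coe_inv, Matrix.adjugate_fin_two]
      ext i j
      fin_cases i <;> fin_cases j <;> simp [a0, a1, p0, p1, hP, hQ, hR, e] <;> ring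
end

section
/- Let t ∈ ℂ and let x₁, x₂, x₄ ∈ SL(2,ℂ) with tr(x₁) = tr(x₂) = tr(x₄) = t. Then x₁·x₂·x₁⁻¹·x₄·x₁ = (t·tr(x₁x₂x₄) − tr(x₁x₂)·tr(x₁x₄) − tr(x₂x₄) + t²)·x₁ − x₄⁻¹·x₁·x₂⁻¹. -/
open Matrix

local notation "𝕄" => Matrix (Fin 2) (Fin 2) ℂ
local notation "SL2" => Matrix.SpecialLinearGroup (Fin 2) ℂ

/-- Cayley-Hamilton in `SL(2,ℂ)`: `g + g⁻¹ = tr(g) I`. -/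
theorem sl2_eq_trace_smul_sub_inv (g : SL2) :
    (g : 𝕄) = (g : 𝕄).trace • (1 : 𝕄) - ((g⁻¹ : SL2) : 𝕄) := by
  rw [Matrix.SpecialLinearGroup.coe_inv, Matrix.adjugate_fin_two]
  ext i j
  fin_cases i <;> fin_cases j <;> simp [Matrix.trace_fin_two]

/-- The trace of `x₁x₂x₁⁻¹x₄`. -/
theorem trace_conj_mul (a b c : SL2) :
    ((a * b * a⁻¹ * c : SL2) : 𝕄).trace
      = (a : 𝕄).trace * ((a * b * c : SL2) : 𝕄).trace
        - ((a * b : SL2) : 𝕄).trace * ((a * c : SL2) : 𝕄).trace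
        - ((b * c : SL2) : 𝕄).trace + (b : 𝕄).trace * (c : 𝕄).trace := by
  have hd := a.det_coe
  rw [Matrix.det_fin_two] at hd
  simp only [Matrix.SpecialLinearGroup.coe_mul, Matrix.SpecialLinearGroup.coe_inv,
    Matrix.adjugate_fin_two, Matrix.trace_fin_two, Matrix.mul_apply, Fin.sum_univ_two,
    Matrix.of_apply, Matrix.cons_val', Matrix.cons_val_zero, Matrix.cons_val_one,
    Matrix.cons_val_fin_one]
  linear_combination ((b 0 0 + b 1 1) * (c 0 0 + c 1 1) - (b 0 0 * c 0 0 + b 0 1 * c 1 0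
    + (b 1 0 * c 0 1 + b 1 1 * c 1 1))) * hd

/-- For `x₁, x₂, x₄ ∈ SL(2,ℂ)` with common trace `t`,
`x₁x₂x₁⁻¹x₄x₁ = (t·tr(x₁x₂x₄) − tr(x₁x₂)tr(x₁x₄) − tr(x₂x₄) + t²)·x₁ − x₄⁻¹x₁x₂⁻¹`. -/
theorem r1_formula (t : ℂ) (x₁ x₂ x₄ : SL2)
    (hx₁ : ((x₁ : 𝕄)).trace = t) (hx₂ : ((x₂ : 𝕄)).trace = t) (hx₄ : ((x₄ : 𝕄)).trace = t) :
    ((x₁ * x₂ * x₁⁻¹ * x₄ * x₁ : SL2) : 𝕄)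
      = (t * ((x₁ * x₂ * x₄ : SL2) : 𝕄).trace
          - ((x₁ * x₂ : SL2) : 𝕄).trace * ((x₁ * x₄ : SL2) : 𝕄).trace
          - ((x₂ * x₄ : SL2) : 𝕄).trace + t ^ 2) • ((x₁ : 𝕄))
        - ((x₄⁻¹ * x₁ * x₂⁻¹ : SL2) : 𝕄) := by
  have h := trace_conj_mul x₁ x₂ x₄
  rw [hx₁, hx₂, hx₄, ← pow_two] at h
  rw [← h]
  have hi : (x₄⁻¹ * x₁ * x₂⁻¹ : SL2) = (x₁ * x₂ * x₁⁻¹ * x₄)⁻¹ * x₁ := by group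
  rw [hi, Matrix.SpecialLinearGroup.coe_mul (x₁ * x₂ * x₁⁻¹ * x₄) x₁,
    Matrix.SpecialLinearGroup.coe_mul (x₁ * x₂ * x₁⁻¹ * x₄)⁻¹ x₁]
  generalize x₁ * x₂ * x₁⁻¹ * x₄ = g
  conv_lhs => rw [sl2_eq_trace_smul_sub_inv g]
  rw [sub_mul, smul_mul_assoc, one_mul]
end

section
/- Let t ∈ ℂ and let x₁, x₂, x₄ ∈ SL(2,ℂ) with tr(x₁) = tr(x₂) = tr(x₄) = t. Then tr(x₁·x₂·x₁⁻¹·x₄·x₁) = (t² − 1)·tr(x₁x₂x₄) − t·tr(x₁x₂)·tr(x₁x₄) + t·(tr(x₁x₂) + tr(x₁x₄) − tr(x₂x₄)). -/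
open Matrix

local notation "𝕄" => Matrix (Fin 2) (Fin 2) ℂ
local notation "SL2" => Matrix.SpecialLinearGroup (Fin 2) ℂ

/-- For `x₁, x₂, x₄ ∈ SL(2,ℂ)` with common trace `t`,
`tr(x₁x₂x₁⁻¹x₄x₁) = (t² − 1)tr(x₁x₂x₄) − t·tr(x₁x₂)tr(x₁x₄)
  + t(tr(x₁x₂) + tr(x₁x₄) − tr(x₂x₄))`. -/
theorem trace_r1_formula (t : ℂ) (x₁ x₂ x₄ : SL2)
    (hx₁ : ((x₁ : 𝕄)).trace = t) (hx₂ : ((x₂ : 𝕄)).trace = t) (hx₄ : ((x₄ : 𝕄)).trace = t) :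
    (((x₁ * x₂ * x₁⁻¹ * x₄ * x₁ : SL2) : 𝕄)).trace
      = (t ^ 2 - 1) * ((x₁ * x₂ * x₄ : SL2) : 𝕄).trace
        - t * ((x₁ * x₂ : SL2) : 𝕄).trace * ((x₁ * x₄ : SL2) : 𝕄).trace
        + t * (((x₁ * x₂ : SL2) : 𝕄).trace + ((x₁ * x₄ : SL2) : 𝕄).trace
          - ((x₂ * x₄ : SL2) : 𝕄).trace) := by
  have hdet : (x₁ : 𝕄).det = 1 := x₁.2
  simp only [Matrix.SpecialLinearGroup.coe_mul, Matrix.SpecialLinearGroup.coe_inv]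
  generalize (x₁ : 𝕄) = X at *
  generalize (x₂ : 𝕄) = Y at *
  generalize (x₄ : 𝕄) = Z at *
  rw [Matrix.det_fin_two] at hdet
  simp only [Matrix.adjugate_fin_two, Matrix.trace_fin_two, Matrix.mul_apply,
    Fin.sum_univ_two, Matrix.of_apply, Matrix.cons_val', Matrix.cons_val_zero,
    Matrix.cons_val_one, Matrix.cons_val_fin_one] at *
  have h1 : X 1 1 = t - X 0 0 := by linear_combination hx₁
  have h2 : Y 1 1 = t - Y 0 0 := by linear_combination hx₂
  have h4 : Z 1 1 = t - Z 0 0 := by linear_combination hx₄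
  rw [h1] at hdet
  rw [h1, h2, h4]
  generalize X 0 0 = a at *
  generalize X 0 1 = b at *
  generalize X 1 0 = c at *
  generalize Y 0 0 = p at *
  generalize Y 0 1 = q at *
  generalize Y 1 0 = r at *
  generalize Z 0 0 = u at *
  generalize Z 0 1 = v at *
  generalize Z 1 0 = w at *
  linear_combination (
    t * ((a * p + b * r + (c * q + (t - a) * (t - p)))
      + (a * u + b * w + (c * v + (t - a) * (t - u)))
      - (p * u + q * w + (r * v + (t - p) * (t - u))))
    - ((a * p + b * r) * u + (a * q + b * (t - p)) * w
      + ((c * p + (t - a) * r) * v + (c * q + (t - a) * (t - p)) * (t - u)))) * hdet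
end

section
/- Let t ∈ ℂ and let x₁, x₂, x₃, x₄ ∈ SL(2,ℂ) with tr(xᵢ) = t for all i. Set r₁ = x₁x₂x₁⁻¹x₄x₁ and r₂ = x₂x₃x₂⁻¹x₁x₂, and write t_{ij} = tr(xᵢxⱼ), t_{ijk} = tr(xᵢxⱼxₖ). Then the four conditions tr(r₁·a) = tr(r₂·a) for a ∈ {I, x₁, x₂, x₂x₁} hold simultaneously if and only if the following three equations hold: (1) (t² − 1)(t₁₂₄ − t₁₂₃) + t(t₁₃ − t₂₄) = t(t₁₂ − 1)(t₁₄ − t₂₃); (2) t(t₁₂ + t² − 2)(t₁₂₄ − t₁₂₃) + (t₁₂ + t² − 1)(t₁₃ − t₂₄) = (t₁₂² + (t² − 1)t₁₂ − t² − 1)(t₁₄ − t₂₃); (3) t(t² − 2 − t₁₂)(t₁₂₄ + t₁₂₃) + (t₁₂ + 1 − t²)(t₁₃ + t₂₄) = (1 − t₁₂² + (t² − 1)t₁₂ − t²)(t₁₄ + t₂₃). -/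
open Matrix

local notation "𝕄" => Matrix (Fin 2) (Fin 2) ℂ
local notation "SL2" => Matrix.SpecialLinearGroup (Fin 2) ℂ

/-- The general element of the span of `1, X, Y, XY`. -/
def spanElt (X Y : Matrix (Fin 2) (Fin 2) ℂ) (a b c d : ℂ) : Matrix (Fin 2) (Fin 2) ℂ :=
  a • (1 : Matrix (Fin 2) (Fin 2) ℂ) + b • X + c • Y + d • (X * Y)

theorem sq_rel (X : Matrix (Fin 2) (Fin 2) ℂ) (t : ℂ) (hd : X.det = 1) (ht : X.trace = t) :
    X * X = t • X - 1 := by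
  subst ht
  rw [Matrix.det_fin_two] at hd
  ext i j
  fin_cases i <;> fin_cases j <;>
    simp [Matrix.mul_apply, Fin.sum_univ_two, Matrix.trace_fin_two] <;>
    first
      | ring1
      | linear_combination -hd

theorem swap_rel (X Y : Matrix (Fin 2) (Fin 2) ℂ) (t s : ℂ) (hX : X.trace = t)
    (hY : Y.trace = t) (hs : (X * Y).trace = s) :
    Y * X = t • X + t • Y + (s - t * t) • (1 : Matrix (Fin 2) (Fin 2) ℂ) - X * Y := by
  have key : Y * X = Y.trace • X + X.trace • Y
      + ((X * Y).trace - X.trace * Y.trace) • (1 : Matrix (Fin 2) (Fin 2) ℂ) - X * Y := by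
    ext i j
    fin_cases i <;> fin_cases j <;>
      simp [Matrix.mul_apply, Fin.sum_univ_two, Matrix.trace_fin_two] <;> ring
  rw [key, hX, hY, hs]

theorem X_mul_spanElt (X Y : Matrix (Fin 2) (Fin 2) ℂ) (t : ℂ)
    (hX : X * X = t • X - 1) (a b c d : ℂ) :
    X * spanElt X Y a b c d = spanElt X Y (-b) (a + t * b) (-d) (c + t * d) := by
  simp only [spanElt, mul_add, mul_smul_comm, ← mul_assoc, hX, sub_mul, smul_mul_assoc,
    mul_one, one_mul]
  module

theorem Y_mul_spanElt (X Y : Matrix (Fin 2) (Fin 2) ℂ) (t s : ℂ)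
    (hY : Y * Y = t • Y - 1)
    (hYX : Y * X = t • X + t • Y + (s - t * t) • (1 : Matrix (Fin 2) (Fin 2) ℂ) - X * Y)
    (a b c d : ℂ) :
    Y * spanElt X Y a b c d = spanElt X Y ((s - t * t) * b - c - t * d) (t * b + d)
      (a + t * b + t * c + s * d) (-b) := by
  have h : Y * (X * Y) = X + s • Y - t • (1 : Matrix (Fin 2) (Fin 2) ℂ) := by
    rw [← mul_assoc, hYX]
    simp only [sub_mul, add_mul, smul_mul_assoc, mul_assoc, hY, one_mul, mul_sub, mul_smul_comm,
      mul_one]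
    module
  simp only [spanElt, mul_add, mul_smul_comm, h, hYX, hY, mul_one]
  module

theorem trace_spanElt_mul (X Y Z : Matrix (Fin 2) (Fin 2) ℂ) (a b c d : ℂ) :
    (spanElt X Y a b c d * Z).trace =
      a * Z.trace + b * (X * Z).trace + c * (Y * Z).trace + d * (X * Y * Z).trace := by
  simp [spanElt, add_mul]

theorem inv_coe (x : Matrix.SpecialLinearGroup (Fin 2) ℂ) (t : ℂ)
    (ht : (x : Matrix (Fin 2) (Fin 2) ℂ).trace = t) :
    ((x⁻¹ : Matrix.SpecialLinearGroup (Fin 2) ℂ) : Matrix (Fin 2) (Fin 2) ℂ)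
      = t • (1 : Matrix (Fin 2) (Fin 2) ℂ) - x := by
  subst ht
  rw [Matrix.SpecialLinearGroup.coe_inv, Matrix.adjugate_fin_two]
  ext i j
  fin_cases i <;> fin_cases j <;> simp [Matrix.trace_fin_two]

/-- Any `W` equals `W` times the unit element of the span. -/
theorem one_eq_spanElt (X Y : Matrix (Fin 2) (Fin 2) ℂ) : 1 = spanElt X Y 1 0 0 0 := by
  simp [spanElt]

theorem sub_mul_spanElt (X Y W : Matrix (Fin 2) (Fin 2) ℂ) (t a b c d a' b' c' d' : ℂ)
    (h : W * spanElt X Y a b c d = spanElt X Y a' b' c' d') :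
    (t • (1 : Matrix (Fin 2) (Fin 2) ℂ) - W) * spanElt X Y a b c d
      = spanElt X Y (t * a - a') (t * b - b') (t * c - c') (t * d - d') := by
  rw [sub_mul, h, smul_mul_assoc, one_mul]
  simp only [spanElt]
  module

/-- With `r₁ = x₁x₂x₁⁻¹x₄x₁` and `r₂ = x₂x₃x₂⁻¹x₁x₂`, the four trace
conditions `tr(r₁a) = tr(r₂a)` for `a ∈ {I, x₁, x₂, x₂x₁}` hold simultaneously iff
three explicit polynomial equations in the trace coordinates hold. -/
theorem trace_conditions_iff (t : ℂ) (x₁ x₂ x₃ x₄ : SL2)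
    (hx₁ : ((x₁ : 𝕄)).trace = t) (hx₂ : ((x₂ : 𝕄)).trace = t)
    (hx₃ : ((x₃ : 𝕄)).trace = t) (hx₄ : ((x₄ : 𝕄)).trace = t)
    (r₁ r₂ : SL2)
    (hr₁ : r₁ = x₁ * x₂ * x₁⁻¹ * x₄ * x₁)
    (hr₂ : r₂ = x₂ * x₃ * x₂⁻¹ * x₁ * x₂)
    (t₁₂ t₁₃ t₁₄ t₂₃ t₂₄ t₁₂₃ t₁₂₄ : ℂ)
    (ht₁₂ : t₁₂ = ((x₁ * x₂ : SL2) : 𝕄).trace)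
    (ht₁₃ : t₁₃ = ((x₁ * x₃ : SL2) : 𝕄).trace)
    (ht₁₄ : t₁₄ = ((x₁ * x₄ : SL2) : 𝕄).trace)
    (ht₂₃ : t₂₃ = ((x₂ * x₃ : SL2) : 𝕄).trace)
    (ht₂₄ : t₂₄ = ((x₂ * x₄ : SL2) : 𝕄).trace)
    (ht₁₂₃ : t₁₂₃ = ((x₁ * x₂ * x₃ : SL2) : 𝕄).trace)
    (ht₁₂₄ : t₁₂₄ = ((x₁ * x₂ * x₄ : SL2) : 𝕄).trace) :
    ((((r₁ : SL2) : 𝕄)).trace = (((r₂ : SL2) : 𝕄)).trace ∧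
      ((r₁ * x₁ : SL2) : 𝕄).trace = ((r₂ * x₁ : SL2) : 𝕄).trace ∧
      ((r₁ * x₂ : SL2) : 𝕄).trace = ((r₂ * x₂ : SL2) : 𝕄).trace ∧
      ((r₁ * (x₂ * x₁) : SL2) : 𝕄).trace = ((r₂ * (x₂ * x₁) : SL2) : 𝕄).trace) ↔
    ((t ^ 2 - 1) * (t₁₂₄ - t₁₂₃) + t * (t₁₃ - t₂₄) = t * (t₁₂ - 1) * (t₁₄ - t₂₃) ∧
      t * (t₁₂ + t ^ 2 - 2) * (t₁₂₄ - t₁₂₃) + (t₁₂ + t ^ 2 - 1) * (t₁₃ - t₂₄)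
        = (t₁₂ ^ 2 + (t ^ 2 - 1) * t₁₂ - t ^ 2 - 1) * (t₁₄ - t₂₃) ∧
      t * (t ^ 2 - 2 - t₁₂) * (t₁₂₄ + t₁₂₃) + (t₁₂ + 1 - t ^ 2) * (t₁₃ + t₂₄)
        = (1 - t₁₂ ^ 2 + (t ^ 2 - 1) * t₁₂ - t ^ 2) * (t₁₄ + t₂₃)) := by
  have d1 := sq_rel (x₁ : 𝕄) t x₁.det_coe hx₁
  have d2 := sq_rel (x₂ : 𝕄) t x₂.det_coe hx₂
  have d21 := swap_rel (x₁ : 𝕄) (x₂ : 𝕄) t t₁₂ hx₁ hx₂ (by rw [ht₁₂]; rfl)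
  have i1 := inv_coe x₁ t hx₁
  have i2 := inv_coe x₂ t hx₂
  subst hr₁ hr₂
  simp only [Matrix.SpecialLinearGroup.coe_mul, i1, i2] at *
  generalize (x₁ : 𝕄) = X at *
  generalize (x₂ : 𝕄) = Y at *
  generalize (x₃ : 𝕄) = Z at *
  generalize (x₄ : 𝕄) = W at *
  have mX := X_mul_spanElt X Y t d1
  have mY := Y_mul_spanElt X Y t t₁₂ d2 d21
  have mX' := fun a b c d => sub_mul_spanElt X Y X t a b c d _ _ _ _ (mX a b c d)
  have mY' := fun a b c d => sub_mul_spanElt X Y Y t a b c d _ _ _ _ (mY a b c d)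
  have e1 : (X * Y * (t • (1 : 𝕄) - X) * W * X).trace =
      ((1)*t^0*t₁₂^1) * t + ((1)*t^1*t₁₂^0 + (-1)*t^1*t₁₂^1) * t₁₄ + ((-1)*t^1*t₁₂^0) * t₂₄ + ((-1)*t^0*t₁₂^0 + (1)*t^2*t₁₂^0) * t₁₂₄ := by
    have h : (X * Y * (t • (1 : 𝕄) - X) * W * X).trace
        = (X * (X * (Y * ((t • (1 : 𝕄) - X) * spanElt X Y 1 0 0 0))) * W).trace := by
      rw [show X * Y * (t • (1 : 𝕄) - X) * W * X = (X * Y * (t • (1 : 𝕄) - X) * W) * (X) by simp only [mul_assoc], Matrix.trace_mul_comm, ← one_eq_spanElt]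
      simp only [mul_assoc, mul_one, one_mul]
    rw [h]
    simp only [mX, mY, mX', mY']
    rw [trace_spanElt_mul, hx₄, ← ht₁₄, ← ht₂₄, ← ht₁₂₄]
    ring
  have e2 : (Y * Z * (t • (1 : 𝕄) - Y) * X * Y).trace =
      ((1)*t^0*t₁₂^1) * t + ((-1)*t^1*t₁₂^0) * t₁₃ + ((1)*t^1*t₁₂^0 + (-1)*t^1*t₁₂^1) * t₂₃ + ((-1)*t^0*t₁₂^0 + (1)*t^2*t₁₂^0) * t₁₂₃ := by
    have h : (Y * Z * (t • (1 : 𝕄) - Y) * X * Y).trace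
        = ((t • (1 : 𝕄) - Y) * (X * (Y * (Y * spanElt X Y 1 0 0 0))) * Z).trace := by
      rw [show Y * Z * (t • (1 : 𝕄) - Y) * X * Y = (Y * Z) * ((t • (1 : 𝕄) - Y) * X * Y) by simp only [mul_assoc], Matrix.trace_mul_comm, ← one_eq_spanElt]
      simp only [mul_assoc, mul_one, one_mul]
    rw [h]
    simp only [mX, mY, mX', mY']
    rw [trace_spanElt_mul, hx₃, ← ht₁₃, ← ht₂₃, ← ht₁₂₃]
    ring
  have e3 : (X * Y * (t • (1 : 𝕄) - X) * W * X * X).trace =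
      ((-1)*t^1*t₁₂^0 + (1)*t^1*t₁₂^1) * t + ((1)*t^0*t₁₂^1 + (1)*t^2*t₁₂^0 + (-1)*t^2*t₁₂^1) * t₁₄ + ((1)*t^0*t₁₂^0 + (-1)*t^2*t₁₂^0) * t₂₄ + ((-2)*t^1*t₁₂^0 + (1)*t^3*t₁₂^0) * t₁₂₄ := by
    have h : (X * Y * (t • (1 : 𝕄) - X) * W * X * X).trace
        = (X * (X * (X * (Y * ((t • (1 : 𝕄) - X) * spanElt X Y 1 0 0 0)))) * W).trace := by
      rw [show X * Y * (t • (1 : 𝕄) - X) * W * X * X = (X * Y * (t • (1 : 𝕄) - X) * W) * (X * X) by simp only [mul_assoc], Matrix.trace_mul_comm, ← one_eq_spanElt]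
      simp only [mul_assoc, mul_one, one_mul]
    rw [h]
    simp only [mX, mY, mX', mY']
    rw [trace_spanElt_mul, hx₄, ← ht₁₄, ← ht₂₄, ← ht₁₂₄]
    ring
  have e4 : (Y * Z * (t • (1 : 𝕄) - Y) * X * Y * X).trace =
      ((-1)*t^1*t₁₂^0 + (1)*t^1*t₁₂^1) * t + ((-1)*t^0*t₁₂^1) * t₁₃ + ((1)*t^0*t₁₂^0 + (-1)*t^0*t₁₂^2) * t₂₃ + ((1)*t^1*t₁₂^1) * t₁₂₃ := by
    have h : (Y * Z * (t • (1 : 𝕄) - Y) * X * Y * X).trace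
        = ((t • (1 : 𝕄) - Y) * (X * (Y * (X * (Y * spanElt X Y 1 0 0 0)))) * Z).trace := by
      rw [show Y * Z * (t • (1 : 𝕄) - Y) * X * Y * X = (Y * Z) * ((t • (1 : 𝕄) - Y) * X * Y * X) by simp only [mul_assoc], Matrix.trace_mul_comm, ← one_eq_spanElt]
      simp only [mul_assoc, mul_one, one_mul]
    rw [h]
    simp only [mX, mY, mX', mY']
    rw [trace_spanElt_mul, hx₃, ← ht₁₃, ← ht₂₃, ← ht₁₂₃]
    ring
  have e5 : (X * Y * (t • (1 : 𝕄) - X) * W * X * Y).trace =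
      ((-1)*t^1*t₁₂^0 + (1)*t^1*t₁₂^1) * t + ((1)*t^0*t₁₂^0 + (-1)*t^0*t₁₂^2) * t₁₄ + ((-1)*t^0*t₁₂^1) * t₂₄ + ((1)*t^1*t₁₂^1) * t₁₂₄ := by
    have h : (X * Y * (t • (1 : 𝕄) - X) * W * X * Y).trace
        = (X * (Y * (X * (Y * ((t • (1 : 𝕄) - X) * spanElt X Y 1 0 0 0)))) * W).trace := by
      rw [show X * Y * (t • (1 : 𝕄) - X) * W * X * Y = (X * Y * (t • (1 : 𝕄) - X) * W) * (X * Y) by simp only [mul_assoc], Matrix.trace_mul_comm, ← one_eq_spanElt]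
      simp only [mul_assoc, mul_one, one_mul]
    rw [h]
    simp only [mX, mY, mX', mY']
    rw [trace_spanElt_mul, hx₄, ← ht₁₄, ← ht₂₄, ← ht₁₂₄]
    ring
  have e6 : (Y * Z * (t • (1 : 𝕄) - Y) * X * Y * Y).trace =
      ((-1)*t^1*t₁₂^0 + (1)*t^1*t₁₂^1) * t + ((1)*t^0*t₁₂^0 + (-1)*t^2*t₁₂^0) * t₁₃ + ((1)*t^0*t₁₂^1 + (1)*t^2*t₁₂^0 + (-1)*t^2*t₁₂^1) * t₂₃ + ((-2)*t^1*t₁₂^0 + (1)*t^3*t₁₂^0) * t₁₂₃ := by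
    have h : (Y * Z * (t • (1 : 𝕄) - Y) * X * Y * Y).trace
        = ((t • (1 : 𝕄) - Y) * (X * (Y * (Y * (Y * spanElt X Y 1 0 0 0)))) * Z).trace := by
      rw [show Y * Z * (t • (1 : 𝕄) - Y) * X * Y * Y = (Y * Z) * ((t • (1 : 𝕄) - Y) * X * Y * Y) by simp only [mul_assoc], Matrix.trace_mul_comm, ← one_eq_spanElt]
      simp only [mul_assoc, mul_one, one_mul]
    rw [h]
    simp only [mX, mY, mX', mY']
    rw [trace_spanElt_mul, hx₃, ← ht₁₃, ← ht₂₃, ← ht₁₂₃]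
    ring
  have e7 : (X * Y * (t • (1 : 𝕄) - X) * W * X * (Y * X)).trace =
      ((1)*t^0*t₁₂^0 + (-2)*t^2*t₁₂^0 + (1)*t^2*t₁₂^1) * t + ((1)*t^1*t₁₂^0 + (1)*t^1*t₁₂^1 + (-1)*t^1*t₁₂^2) * t₁₄ + ((1)*t^1*t₁₂^0 + (-1)*t^1*t₁₂^1) * t₂₄ + ((-1)*t^2*t₁₂^0 + (1)*t^2*t₁₂^1) * t₁₂₄ := by
    have h : (X * Y * (t • (1 : 𝕄) - X) * W * X * (Y * X)).trace
        = (X * (Y * (X * (X * (Y * ((t • (1 : 𝕄) - X) * spanElt X Y 1 0 0 0))))) * W).trace := by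
      rw [show X * Y * (t • (1 : 𝕄) - X) * W * X * (Y * X) = (X * Y * (t • (1 : 𝕄) - X) * W) * (X * Y * X) by simp only [mul_assoc], Matrix.trace_mul_comm, ← one_eq_spanElt]
      simp only [mul_assoc, mul_one, one_mul]
    rw [h]
    simp only [mX, mY, mX', mY']
    rw [trace_spanElt_mul, hx₄, ← ht₁₄, ← ht₂₄, ← ht₁₂₄]
    ring
  have e8 : (Y * Z * (t • (1 : 𝕄) - Y) * X * Y * (Y * X)).trace =
      ((1)*t^0*t₁₂^0 + (-2)*t^2*t₁₂^0 + (1)*t^2*t₁₂^1) * t + ((1)*t^1*t₁₂^0 + (-1)*t^1*t₁₂^1) * t₁₃ + ((1)*t^1*t₁₂^0 + (1)*t^1*t₁₂^1 + (-1)*t^1*t₁₂^2) * t₂₃ + ((-1)*t^2*t₁₂^0 + (1)*t^2*t₁₂^1) * t₁₂₃ := by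
    have h : (Y * Z * (t • (1 : 𝕄) - Y) * X * Y * (Y * X)).trace
        = ((t • (1 : 𝕄) - Y) * (X * (Y * (Y * (X * (Y * spanElt X Y 1 0 0 0))))) * Z).trace := by
      rw [show Y * Z * (t • (1 : 𝕄) - Y) * X * Y * (Y * X) = (Y * Z) * ((t • (1 : 𝕄) - Y) * X * Y * Y * X) by simp only [mul_assoc], Matrix.trace_mul_comm, ← one_eq_spanElt]
      simp only [mul_assoc, mul_one, one_mul]
    rw [h]
    simp only [mX, mY, mX', mY']
    rw [trace_spanElt_mul, hx₃, ← ht₁₃, ← ht₂₃, ← ht₁₂₃]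
    ring
  rw [e1, e2, e3, e4, e5, e6, e7, e8]
  constructor
  · rintro ⟨h0, h1, h2, h3⟩
    refine ⟨?_, ?_, ?_⟩
    · linear_combination h0
    · linear_combination h1 + h2
    · linear_combination h1 - h2
  · rintro ⟨f1, f2, f3⟩
    refine ⟨?_, ?_, ?_, ?_⟩
    · linear_combination f1
    · linear_combination (f2 + f3) / 2
    · linear_combination (f2 - f3) / 2
    · linear_combination t * f2 - t ^ 2 * f1
end

section
/- Let t ∈ ℂ and let x₁, x₂, x₃, x₄ ∈ SL(2,ℂ) with tr(xᵢ) = t for all i, such that the quadruple (x₁, x₂, x₃, x₄) is irreducible and r₁ = r₂ = r₃ = r₄, where rᵢ = xᵢxᵢ₊₁xᵢ⁻¹xᵢ₋₁xᵢ with subscripts read modulo 4. Then for any i ∈ {1, 2, 3, 4}: if xᵢxᵢ₊₁ = xᵢ₊₁xᵢ, then xᵢ = xᵢ₊₁, xᵢ₋₁ = xᵢ₊₂, and tr(xᵢxᵢ₋₁) = tr(xᵢ₊₁xᵢ₊₂) = 1. -/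
open Matrix

local notation "𝕄" => Matrix (Fin 2) (Fin 2) ℂ
local notation "SL2" => Matrix.SpecialLinearGroup (Fin 2) ℂ

theorem exists_eigvec (A : Matrix (Fin 2) (Fin 2) ℂ) :
    ∃ v : Fin 2 → ℂ, v ≠ 0 ∧ ∃ a : ℂ, A.mulVec v = a • v := by
  obtain ⟨m, hm⟩ := Module.End.exists_eigenvalue (Matrix.toLin' A)
  obtain ⟨v, hv⟩ := hm.exists_hasEigenvector
  exact ⟨v, hv.2, m, by simpa using hv.apply_eq_smul⟩

/-- Cayley–Hamilton consequence: `aca = tr(ac) a - adj c`. -/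
theorem aca_formula (A C : Matrix (Fin 2) (Fin 2) ℂ) (hA : A.det = 1) :
    A * C * A = (A * C).trace • A - C.adjugate := by
  rw [Matrix.det_fin_two] at hA
  ext i j
  fin_cases i <;> fin_cases j <;>
    simp [Matrix.mul_apply, Matrix.trace_fin_two, Matrix.adjugate_fin_two, Fin.sum_univ_two]
  · linear_combination (-C 1 1) * hA
  · linear_combination (C 0 1) * hA
  · linear_combination (C 1 0) * hA
  · linear_combination (-C 0 0) * hA

theorem braid_trace (A C : Matrix (Fin 2) (Fin 2) ℂ) (hA : A.det = 1) (hC : C.det = 1)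
    (ht : A.trace = C.trace) (hb : A * C * A = C * A * C) (hne : A ≠ C) :
    (A * C).trace = 1 := by
  rw [aca_formula A C hA, aca_formula C A hC, Matrix.trace_mul_comm C A] at hb
  rw [Matrix.trace_fin_two A, Matrix.trace_fin_two C] at ht
  generalize (A * C).trace = τ at hb
  by_contra hτ
  apply hne
  have hτ' : τ - 1 ≠ 0 := sub_ne_zero.mpr hτ
  have e := fun i j => congrFun (congrFun hb i) j
  have e00 := e 0 0
  have e01 := e 0 1
  have e10 := e 1 0
  have e11 := e 1 1
  simp [Matrix.adjugate_fin_two] at e00 e01 e10 e11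
  ext i j
  apply mul_left_cancel₀ hτ'
  fin_cases i <;> fin_cases j <;> simp only [Fin.zero_eta, Fin.mk_one, Fin.isValue]
  · linear_combination e00 - ht
  · linear_combination e01
  · linear_combination e10
  · linear_combination e11 - ht

/-- If `(x₁,x₂,x₃,x₄)` is an irreducible quadruple in `G(t)` with
`r₁ = r₂ = r₃ = r₄` (where `rᵢ = xᵢxᵢ₊₁xᵢ⁻¹xᵢ₋₁xᵢ`, subscripts mod 4), then whenever
`xᵢ` and `xᵢ₊₁` commute, one has `xᵢ = xᵢ₊₁`, `xᵢ₋₁ = xᵢ₊₂`, and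
`tr(xᵢxᵢ₋₁) = tr(xᵢ₊₁xᵢ₊₂) = 1`. -/
theorem commuting_adjacent_generators (t : ℂ) (x : Fin 4 → SL2)
    (htr : ∀ i, ((x i : 𝕄)).trace = t)
    (hirr : IsIrreducibleFamily (fun i : Fin 4 => (x i : 𝕄)))
    (r : Fin 4 → SL2)
    (hr : ∀ i, r i = x i * x (i + 1) * (x i)⁻¹ * x (i - 1) * x i)
    (heq : ∀ i j, r i = r j) :
    ∀ i : Fin 4, x i * x (i + 1) = x (i + 1) * x i →
      x i = x (i + 1) ∧ x (i - 1) = x (i + 2) ∧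
      ((x i * x (i - 1) : SL2) : 𝕄).trace = 1 ∧
      ((x (i + 1) * x (i + 2) : SL2) : 𝕄).trace = 1 := by
  intro i hc
  have i1 : i + 1 + 1 = i + 2 := by clear * -; decide +revert
  have i2 : i + 1 - 1 = i := by simp
  have i3 : i + 2 + 1 = i - 1 := by clear * -; decide +revert
  have i4 : i + 2 - 1 = i + 1 := by clear * -; decide +revert
  have i5 : i - 1 + 1 = i := by simp
  have i6 : i - 1 - 1 = i + 2 := by clear * -; decide +revert
  have cov : ∀ j : Fin 4, j = i ∨ j = i + 1 ∨ j = i + 2 ∨ j = i - 1 := by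
    clear * -; decide +revert
  have h1 := hr i
  have h2 := hr (i + 1)
  have h3 := hr (i + 2)
  have h4 := hr (i - 1)
  rw [i1, i2] at h2
  rw [i3, i4] at h3
  rw [i5, i6] at h4
  rw [heq (i + 1) i] at h2
  rw [heq (i + 2) i] at h3
  rw [heq (i - 1) i] at h4
  have hta := htr i
  have htc := htr (i + 2)
  have hall : x i = x (i + 1) → x (i - 1) = x (i + 2) → x i ≠ x (i + 2) := by
    intro p q s
    apply hirr
    obtain ⟨v, hv, m, hm⟩ := exists_eigvec (x i : 𝕄)
    refine ⟨v, hv, fun j => ⟨m, ?_⟩⟩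
    have : x j = x i := by
      rcases cov j with h | h | h | h <;> rw [h]
      · exact p.symm
      · exact s.symm
      · rw [q, s]
    simpa [this] using hm
  generalize r i = R at *
  generalize x i = a at *
  generalize x (i + 1) = b at *
  generalize x (i + 2) = c at *
  generalize x (i - 1) = d at *
  have k1 : a * b * a⁻¹ = b := by rw [hc]; group
  have k2 : b⁻¹ * a * b = a := by rw [mul_assoc, hc]; group
  have h1' : R = b * d * a := by rw [h1, k1]
  have h2' : R = b * c * a := by
    rw [h2]
    calc b * c * b⁻¹ * a * b = b * c * (b⁻¹ * a * b) := by group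
      _ = _ := by rw [k2]
  have hdc : d = c := mul_left_cancel (mul_right_cancel (h1'.symm.trans h2'))
  subst hdc
  have h3' : R = d * b * d := by rw [h3]; group
  have h4' : R = d * a * d := by rw [h4]; group
  have hab : a = b := mul_left_cancel (mul_right_cancel (h4'.symm.trans h3'))
  subst hab
  have hne := hall rfl rfl
  have hb : (a : 𝕄) * d * a = d * a * d := by
    have := h1'.symm.trans h4'
    simpa using congrArg (fun g : SL2 => (g : 𝕄)) this
  have key := braid_trace (a : 𝕄) d a.det_coe d.det_coe (hta.trans htc.symm) hb
    (fun h => hne (Subtype.ext h))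
  refine ⟨rfl, rfl, ?_, ?_⟩ <;> simpa using key
end

section
/- Let t ∈ ℂ and let x₁, x₂, x₃, x₄ ∈ SL(2,ℂ) with tr(xᵢ) = t for all i, such that r₁ = r₂ = r₃ = r₄ where rᵢ = xᵢxᵢ₊₁xᵢ⁻¹xᵢ₋₁xᵢ (subscripts modulo 4), each of the triples (x₁,x₂,x₃), (x₁,x₂,x₄), (x₁,x₃,x₄), (x₂,x₃,x₄) is irreducible, and tr(xᵢxᵢ₊₁) ≠ 1 for all i (subscripts modulo 4). If tr(x₁x₃) = tr(x₂x₄), then (tr(x₁x₂) − tr(x₃x₄))·(tr(x₁x₄) − tr(x₂x₃)) = 0. -/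
open Matrix

local notation "𝕄" => Matrix (Fin 2) (Fin 2) ℂ
local notation "SL2" => Matrix.SpecialLinearGroup (Fin 2) ℂ

set_option linter.unusedVariables false

/-- the case with a reflection symmetry -/
theorem case_sym (s e1 e2 e3 e4 m d1 d2 d3 d4 : ℂ)
    (T1 : (4*s^2-1)*(d2-d1) = s*(e4-e2)*(1+4*e1))
    (T2 : (4*s^2-1)*(d3-d2) = s*(e1-e3)*(1+4*e2))
    (T3 : (4*s^2-1)*(d4-d3) = s*(e2-e4)*(1+4*e3))
    (T4 : (4*s^2-1)*(d1-d4) = s*(e3-e1)*(1+4*e4))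
    (L1 : d3*(1-s^2)-d4*e1+d1*m-d2*e4 = 0)
    (L2 : d3*e1-d4*(1-s^2)+d1*e2-d2*m = 0)
    (L3 : d3*m-d4*e2+d1*(1-s^2)-d2*e3 = 0)
    (L4 : d3*e4-d4*m+d1*e3-d2*(1-s^2) = 0)
    (hs : s ≠ 0) (hw : 4*s^2-1 ≠ 0) (h1 : e4 = e1) (h2 : e3 = e2) (hA : e1 - e2 ≠ 0) :
    2*(1-s^2+m) = 1 := by
  subst h1 h2
  have hd : d4 = d2 := mul_left_cancel₀ hw (by linear_combination T2 + T3)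
  subst hd
  have A2 : (4*s^2-1)*(d1+d3-2*d4) = - 4*s*(e4-e3)^2 := by
    linear_combination T2 - T1
  apply mul_left_cancel₀ (mul_ne_zero hs (pow_ne_zero 2 hA))
  linear_combination (-(4*s^2-1)*(L1+L3+L2+L4)+(1-s^2+m+e4+e3)*A2+(e4-e3)*(T1+T2))/2

/-- the polynomial core of the argument -/
theorem case_main (s e1 e2 e3 e4 m d1 d2 d3 d4 : ℂ)
    (F1 : s*(2*d1-d2-d4)+(s^2+m-4*s^2*m-4*s*d1-4*e1*e4)*(1-s^2)-(s^2+m-4*s^2*m-4*s*d3-4*e3*e2)*m+2*e1*e4-e1*e3-e2*e4 = 0)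
    (F2 : s*(2*d2-d3-d1)+(s^2+m-4*s^2*m-4*s*d2-4*e2*e1)*(1-s^2)-(s^2+m-4*s^2*m-4*s*d4-4*e4*e3)*m+2*e2*e1-e1*e3-e2*e4 = 0)
    (F3 : s*(2*d3-d4-d2)+(s^2+m-4*s^2*m-4*s*d3-4*e3*e2)*(1-s^2)-(s^2+m-4*s^2*m-4*s*d1-4*e1*e4)*m+2*e3*e2-e1*e3-e2*e4 = 0)
    (F4 : s*(2*d4-d1-d3)+(s^2+m-4*s^2*m-4*s*d4-4*e4*e3)*(1-s^2)-(s^2+m-4*s^2*m-4*s*d2-4*e2*e1)*m+2*e4*e3-e1*e3-e2*e4 = 0)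
    (T1 : (4*s^2-1)*(d2-d1) = s*(e4-e2)*(1+4*e1))
    (T2 : (4*s^2-1)*(d3-d2) = s*(e1-e3)*(1+4*e2))
    (T3 : (4*s^2-1)*(d4-d3) = s*(e2-e4)*(1+4*e3))
    (T4 : (4*s^2-1)*(d1-d4) = s*(e3-e1)*(1+4*e4))
    (L1 : d3*(1-s^2)-d4*e1+d1*m-d2*e4 = 0)
    (L2 : d3*e1-d4*(1-s^2)+d1*e2-d2*m = 0)
    (L3 : d3*m-d4*e2+d1*(1-s^2)-d2*e3 = 0)
    (L4 : d3*e4-d4*m+d1*e3-d2*(1-s^2) = 0)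
    (G1 : d1^2 = (1-s^2)^3+2*e1*e4*m-(1-s^2)*(m^2+e1^2+e4^2))
    (G2 : d2^2 = (1-s^2)^3+2*e2*e1*m-(1-s^2)*(m^2+e2^2+e1^2))
    (G3 : d3^2 = (1-s^2)^3+2*e3*e2*m-(1-s^2)*(m^2+e3^2+e2^2))
    (G4 : d4^2 = (1-s^2)^3+2*e4*e3*m-(1-s^2)*(m^2+e4^2+e3^2))
    (hA : e1 - e3 ≠ 0) (hB : e4 - e2 ≠ 0) :
    False := by
  have hw : 4*s^2-1 ≠ 0 := by
    intro h
    have hs : s ≠ 0 := by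
      rintro rfl
      norm_num at h
    rw [h] at T1 T3
    have k1 : 1+4*e1 = 0 := by
      apply mul_left_cancel₀ (mul_ne_zero hs hB)
      linear_combination -T1
    have k3 : 1+4*e3 = 0 := by
      apply mul_left_cancel₀ (mul_ne_zero hs hB)
      linear_combination T3
    apply hA
    linear_combination (k1 - k3)/4
  have A2 : (4*s^2-1)*(d2-d1+d4-d3) = 4*s*((e1-e3)*(e4-e2)) := by
    linear_combination T1 + T3
  have hl : 2*(1-s^2-m) = 1+4*s^2 := by
    apply mul_left_cancel₀ (mul_ne_zero hA hB)
    linear_combination ((4*s^2-1)*(F1+F3-F2-F4) + (4*s-4*s*(1-s^2-m))*A2)/2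
  have hM : 1-2*(1-s^2+m) ≠ 0 := by
    intro h
    apply hw
    linear_combination (h - hl)/2
  have H13 : (e1*e4-e2*e3) + s^2*((e1-e3)+(e4-e2)) = 0 := by
    apply mul_left_cancel₀ hM
    linear_combination -(4*s^2-1)*(F1-F3)/2 - s*(1-2*(1-s^2+m))*(T1+T2)
  have H24 : (e1*e2-e3*e4) + s^2*((e1-e3)-(e4-e2)) = 0 := by
    apply mul_left_cancel₀ hM
    linear_combination -(4*s^2-1)*(F2-F4)/2 - s*(1-2*(1-s^2+m))*(T2+T3)
  have R1 : e2+e4 = -2*s^2 := by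
    apply mul_left_cancel₀ hA
    linear_combination H13 + H24
  have R2 : e1+e3 = -2*s^2 := by
    apply mul_left_cancel₀ hB
    linear_combination H13 - H24
  by_cases hs : s = 0
  · subst hs
    obtain rfl : d2 = d1 := by linear_combination -T1
    obtain rfl : d3 = d2 := by linear_combination -T2
    obtain rfl : d4 = d3 := by linear_combination -T3
    obtain rfl : e4 = -e2 := by linear_combination R1
    obtain rfl : e3 = -e1 := by linear_combination R2
    have h1 : e1 ≠ 0 := by rintro rfl; simp at hA
    have h2 : e2 ≠ 0 := by rintro rfl; simp at hB
    have m0 : m = 0 := by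
      apply mul_left_cancel₀ (mul_ne_zero h1 h2)
      linear_combination (G1 - G2)/4
    subst m0
    norm_num at hl
  have hh : e2+e4 = e1+e3 := R1.trans R2.symm
  obtain rfl : e4 = e1+e3-e2 := by linear_combination hh
  have Z1 : (e1-e2)*((4*s^2-1)*(d2+d4) - 2*s*(1+2*(e1+e3))*(1-s^2-m)) = 0 := by
    linear_combination (-(4*s^2-1))*(L1-L3) + (1-s^2-m)*(T1+T2)
  have Z2 : (e3-e2)*((4*s^2-1)*(d1+d3) - 2*s*(1+2*(e1+e3))*(1-s^2-m)) = 0 := by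
    linear_combination (-(4*s^2-1))*(L2-L4) - (1-s^2-m)*(T2+T3)
  by_cases ha : e1 - e2 = 0
  · -- e1 = e2, e3 = e4 : rotate
    have key : 2*(1-s^2+m) = 1 := by
      refine case_sym s e2 e3 (e1+e3-e2) e1 m d2 d3 d4 d1 T2 T3 T4 T1 ?_ ?_ ?_ ?_ hs hw ?_ ?_ ?_
      · linear_combination -L2
      · linear_combination -L3
      · linear_combination -L4
      · linear_combination -L1
      · linear_combination ha
      · linear_combination ha
      · intro h; apply hA; linear_combination ha + h
    apply hM
    linear_combination -key
  · by_cases hb : e3 - e2 = 0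
    · have key : 2*(1-s^2+m) = 1 := by
        refine case_sym s e1 e2 e3 (e1+e3-e2) m d1 d2 d3 d4 T1 T2 T3 T4 L1 L2 L3 L4 hs hw ?_ ?_ ha
        · linear_combination hb
        · linear_combination hb
      apply hM
      linear_combination -key
    · have z1 := (mul_eq_zero.mp Z1).resolve_left ha
      have z2 := (mul_eq_zero.mp Z2).resolve_left hb
      have : s * ((e1-e3)*((e1+e3-e2)-e2)) = 0 := by
        linear_combination (z1 - z2 - T1 - T3)/4
      exact mul_ne_zero hs (mul_ne_zero hA hB) this


/-- a traceless 2×2 matrix -/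
structure V3 where
  p : ℂ
  q : ℂ
  r : ℂ

/-- the matrix with half trace `s` and traceless part `v` -/
noncomputable def mk (s : ℂ) (v : V3) : Matrix (Fin 2) (Fin 2) ℂ := !![s + v.p, v.q; v.r, s - v.p]

noncomputable def dot (u v : V3) : ℂ := -(u.p*v.p + (u.q*v.r+u.r*v.q)/2)

noncomputable def cross (u v : V3) : V3 := ⟨(u.q*v.r-u.r*v.q)/2, u.p*v.q-u.q*v.p, u.r*v.p-u.p*v.r⟩

noncomputable def det3 (u v w : V3) : ℂ := dot u (cross v w)

noncomputable def NN (a b c w : V3) : ℂ := det3 a b w + det3 b c w + det3 c a w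

noncomputable def alf (s : ℂ) (a b c : V3) : ℂ :=
  s^2 + dot b c - 4*s^2*dot b c - 4*s*det3 a b c - 4*dot a b*dot c a

noncomputable def rs (s : ℂ) (a b c : V3) : ℂ :=
  ((4*s^2-1)*(2*s^3-2*s*(dot a b+dot b c+dot c a)-2*det3 a b c)
    - 2*s*(2*s^2-2*dot a b)*(2*s^2-2*dot c a) + 2*s*(2*s^2-2*dot a b+2*s^2-2*dot c a)
    - 2*s*(2*s^2-2*dot b c))/2

/-- linear combination appearing as traceless part of the word -/
noncomputable def lc (s x y z : ℂ) (a b c : V3) : V3 :=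
  ⟨s*((cross a b).p+(cross b c).p+(cross c a).p)+x*a.p+y*b.p+z*c.p,
   s*((cross a b).q+(cross b c).q+(cross c a).q)+x*a.q+y*b.q+z*c.q,
   s*((cross a b).r+(cross b c).r+(cross c a).r)+x*a.r+y*b.r+z*c.r⟩

theorem dot_lc (s x y z : ℂ) (a b c w : V3) :
    dot (lc s x y z a b c) w = s*NN a b c w + x*dot a w + y*dot b w + z*dot c w := by
  simp only [dot, lc, NN, det3, cross]
  ring

theorem adj_mk (s : ℂ) (v : V3) : (mk s v).adjugate = mk s ⟨-v.p, -v.q, -v.r⟩ := by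
  simp only [mk, Matrix.adjugate_fin_two_of]
  simp [sub_eq_add_neg]

set_option maxHeartbeats 4000000 in
theorem word (s : ℂ) (a b c : V3) (ha : dot a a = 1 - s^2) :
    mk s a * mk s b * (mk s a).adjugate * mk s c * mk s a
      = mk (rs s a b c) (lc s (alf s a b c) (s^2+dot c a) (s^2+dot a b) a b c) := by
  obtain ⟨p, q, r⟩ := a
  obtain ⟨p1, q1, r1⟩ := b
  obtain ⟨p2, q2, r2⟩ := c
  rw [adj_mk]
  have X : (s^2 - p^2 - q*r) = 1 := by
    simp only [dot] at ha
    linear_combination ha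
  have hX : ∀ i j, (mk s ⟨p,q,r⟩ * mk s ⟨p1,q1,r1⟩ * mk s ⟨-p,-q,-r⟩ * mk s ⟨p2,q2,r2⟩ * mk s ⟨p,q,r⟩) i j
     - (mk (rs s ⟨p,q,r⟩ ⟨p1,q1,r1⟩ ⟨p2,q2,r2⟩) (lc s (alf s ⟨p,q,r⟩ ⟨p1,q1,r1⟩ ⟨p2,q2,r2⟩)
        (s^2+dot ⟨p2,q2,r2⟩ ⟨p,q,r⟩) (s^2+dot ⟨p,q,r⟩ ⟨p1,q1,r1⟩) ⟨p,q,r⟩ ⟨p1,q1,r1⟩ ⟨p2,q2,r2⟩)) i j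
     = (s^2-p^2-q*r-1) * ((-2*s)*(mk s ⟨-p2,-q2,-r2⟩ * mk s ⟨-p1,-q1,-r1⟩) i j
        + (2*s^2+2*p*p1+q*r1+r*q1) * mk s ⟨-p2,-q2,-r2⟩ i j
        + (mk s ⟨-p1,-q1,-r1⟩ * mk s ⟨p2,q2,r2⟩ * mk s ⟨p,q,r⟩) i j) := by
    intro i j
    fin_cases i <;> fin_cases j <;>
      simp [mk, rs, lc, alf, dot, det3, cross, Matrix.mul_apply, Fin.sum_univ_two] <;> ring
  ext i j
  have := hX i j
  rw [X] at this
  linear_combination this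

theorem mk_inj {s s' : ℂ} {u v : V3} (h : mk s u = mk s' v) : s = s' ∧ u = v := by
  have h00 := congrFun (congrFun h 0) 0
  have h01 := congrFun (congrFun h 0) 1
  have h10 := congrFun (congrFun h 1) 0
  have h11 := congrFun (congrFun h 1) 1
  simp [mk] at h00 h01 h10 h11
  refine ⟨by linear_combination (h00+h11)/2, ?_⟩
  obtain ⟨p, q, r⟩ := u
  obtain ⟨p', q', r'⟩ := v
  simp only [V3.mk.injEq] at *
  exact ⟨by linear_combination (h00-h11)/2, h01, h10⟩

theorem dot_comm' (u v : V3) : dot u v = dot v u := by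
  simp only [dot]; ring

theorem NN_self1 (a b c : V3) : NN a b c a = det3 a b c := by
  simp only [NN, det3, dot, cross]; ring
theorem NN_self2 (a b c : V3) : NN a b c b = det3 a b c := by
  simp only [NN, det3, dot, cross]; ring
theorem NN_self3 (a b c : V3) : NN a b c c = det3 a b c := by
  simp only [NN, det3, dot, cross]; ring
theorem NN_opp (a b c w : V3) : NN a b c w = det3 b w a + det3 c a w - det3 w c b := by
  simp only [NN, det3, dot, cross]; ring
theorem dep (v1 v2 v3 v4 w : V3) : det3 v3 v4 v2*dot v1 w-det3 v4 v1 v3*dot v2 w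
    + det3 v1 v2 v4*dot v3 w-det3 v2 v3 v1*dot v4 w = 0 := by
  simp only [det3, dot, cross]; ring
theorem gram (a b c : V3) : det3 a b c^2 = dot a a*dot b b*dot c c
    + 2*dot a b*dot b c*dot c a - dot a a*dot b c^2 - dot b b*dot c a^2 - dot c c*dot a b^2 := by
  simp only [det3, dot, cross]; ring

set_option maxHeartbeats 4000000 in
theorem vec_main (s : ℂ) (v1 v2 v3 v4 : V3)
    (n1 : dot v1 v1 = 1 - s^2) (n2 : dot v2 v2 = 1 - s^2)
    (n3 : dot v3 v3 = 1 - s^2) (n4 : dot v4 v4 = 1 - s^2)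
    (hm : dot v2 v4 = dot v1 v3)
    (h1 : mk s v1 * mk s v2 * (mk s v1).adjugate * mk s v4 * mk s v1 = mk s v2 * mk s v3 * (mk s v2).adjugate * mk s v1 * mk s v2)
    (h2 : mk s v2 * mk s v3 * (mk s v2).adjugate * mk s v1 * mk s v2 = mk s v3 * mk s v4 * (mk s v3).adjugate * mk s v2 * mk s v3)
    (h3 : mk s v3 * mk s v4 * (mk s v3).adjugate * mk s v2 * mk s v3 = mk s v4 * mk s v1 * (mk s v4).adjugate * mk s v3 * mk s v4)
    (q1 : 2*s^2 - 2*dot v1 v2 ≠ 1)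
    (q2 : 2*s^2 - 2*dot v2 v3 ≠ 1)
    (q3 : 2*s^2 - 2*dot v3 v4 ≠ 1)
    (q4 : 2*s^2 - 2*dot v4 v1 ≠ 1)
    (hA : dot v1 v2 - dot v3 v4 ≠ 0) (hB : dot v4 v1 - dot v2 v3 ≠ 0) : False := by
  rw [word _ _ _ _ n1, word _ _ _ _ n2] at h1
  rw [word _ _ _ _ n2, word _ _ _ _ n3] at h2
  rw [word _ _ _ _ n3, word _ _ _ _ n4] at h3
  obtain ⟨t1, w1⟩ := mk_inj h1
  obtain ⟨t2, w2⟩ := mk_inj h2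
  obtain ⟨t3, w3⟩ := mk_inj h3
  clear h1 h2 h3
  have m1 : dot v3 v1 = dot v1 v3 := dot_comm' _ _
  have m2 : dot v4 v2 = dot v1 v3 := (dot_comm' _ _).trans hm
  have c1 : dot v2 v1 = dot v1 v2 := dot_comm' _ _
  have c2 : dot v3 v2 = dot v2 v3 := dot_comm' _ _
  have c3 : dot v4 v3 = dot v3 v4 := dot_comm' _ _
  have c4 : dot v1 v4 = dot v4 v1 := dot_comm' _ _
  have g1 := gram v1 v2 v4
  have l1 := dep v1 v2 v3 v4 v1
  have g2 := gram v2 v3 v1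
  have l2 := dep v1 v2 v3 v4 v2
  have g3 := gram v3 v4 v2
  have l3 := dep v1 v2 v3 v4 v3
  have g4 := gram v4 v1 v3
  have l4 := dep v1 v2 v3 v4 v4
  have k11 := congrArg (fun u => dot u v1) w1
  have k21 := congrArg (fun u => dot u v1) w2
  have k31 := congrArg (fun u => dot u v1) w3
  have k12 := congrArg (fun u => dot u v2) w1
  have k22 := congrArg (fun u => dot u v2) w2
  have k32 := congrArg (fun u => dot u v2) w3
  have k13 := congrArg (fun u => dot u v3) w1
  have k23 := congrArg (fun u => dot u v3) w2
  have k33 := congrArg (fun u => dot u v3) w3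
  have k14 := congrArg (fun u => dot u v4) w1
  have k24 := congrArg (fun u => dot u v4) w2
  have k34 := congrArg (fun u => dot u v4) w3
  simp only [dot_lc, alf, NN_self1, NN_self2, NN_self3, m1, m2, hm, c1, c2, c3, c4, n1, n2, n3, n4] at k11 k21 k31 k12 k22 k32 k13 k23 k33 k14 k24 k34
  have o1 := NN_opp v1 v2 v4 v3
  have o2 := NN_opp v2 v3 v1 v4
  have o3 := NN_opp v3 v4 v2 v1
  have o4 := NN_opp v4 v1 v3 v2
  simp only [o1, o2, o3, o4] at k11 k21 k31 k12 k22 k32 k13 k23 k33 k14 k24 k34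
  simp only [m1, m2, hm, c1, c2, c3, c4, n1, n2, n3, n4] at g1 g2 g3 g4 l1 l2 l3 l4
  simp only [rs, m1, m2, hm, c1, c2, c3, c4, n1, n2, n3, n4] at t1 t2 t3
  clear w1 w2 w3 o1 o2 o3 o4 m1 m2 hm c1 c2 c3 c4 n1 n2 n3 n4
  generalize dot v1 v2 = e1 at *
  generalize dot v2 v3 = e2 at *
  generalize dot v3 v4 = e3 at *
  generalize dot v4 v1 = e4 at *
  generalize dot v1 v3 = m at *
  generalize det3 v1 v2 v4 = d1 at *
  generalize det3 v2 v3 v1 = d2 at *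
  generalize det3 v3 v4 v2 = d3 at *
  generalize det3 v4 v1 v3 = d4 at *
  have T1 : (4*s^2-1)*(d2-d1) = s*(e4-e2)*(1+4*e1) := by linear_combination t1
  have T2 : (4*s^2-1)*(d3-d2) = s*(e1-e3)*(1+4*e2) := by linear_combination t2
  have T3 : (4*s^2-1)*(d4-d3) = s*(e2-e4)*(1+4*e3) := by linear_combination t3
  have T4 : (4*s^2-1)*(d1-d4) = s*(e3-e1)*(1+4*e4) := by linear_combination - T1 - T2 - T3
  have E11 : s*d1+(s^2+m-4*s^2*m-4*s*d1-4*e1*e4)*(1-s^2)+(s^2+e4)*e1+(s^2+e1)*e4 = s*d2+(s^2+m-4*s^2*m-4*s*d2-4*e2*e1)*e1+(s^2+e1)*m+(s^2+e2)*(1-s^2) := by linear_combination k11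
  have E21 : s*d2+(s^2+m-4*s^2*m-4*s*d2-4*e2*e1)*e1+(s^2+e1)*m+(s^2+e2)*(1-s^2) = s*(d2+d4-d1)+(s^2+m-4*s^2*m-4*s*d3-4*e3*e2)*m+(s^2+e2)*e4+(s^2+e3)*e1 := by linear_combination k21
  have E31 : s*(d2+d4-d1)+(s^2+m-4*s^2*m-4*s*d3-4*e3*e2)*m+(s^2+e2)*e4+(s^2+e3)*e1 = s*d4+(s^2+m-4*s^2*m-4*s*d4-4*e4*e3)*e4+(s^2+e3)*(1-s^2)+(s^2+e4)*m := by linear_combination k31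
  have E12 : s*d1+(s^2+m-4*s^2*m-4*s*d1-4*e1*e4)*e1+(s^2+e4)*(1-s^2)+(s^2+e1)*m = s*d2+(s^2+m-4*s^2*m-4*s*d2-4*e2*e1)*(1-s^2)+(s^2+e1)*e2+(s^2+e2)*e1 := by linear_combination k12
  have E22 : s*d2+(s^2+m-4*s^2*m-4*s*d2-4*e2*e1)*(1-s^2)+(s^2+e1)*e2+(s^2+e2)*e1 = s*d3+(s^2+m-4*s^2*m-4*s*d3-4*e3*e2)*e2+(s^2+e2)*m+(s^2+e3)*(1-s^2) := by linear_combination k22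
  have E32 : s*d3+(s^2+m-4*s^2*m-4*s*d3-4*e3*e2)*e2+(s^2+e2)*m+(s^2+e3)*(1-s^2) = s*(d3+d1-d2)+(s^2+m-4*s^2*m-4*s*d4-4*e4*e3)*m+(s^2+e3)*e1+(s^2+e4)*e2 := by linear_combination k32
  have E13 : s*(d4+d2-d3)+(s^2+m-4*s^2*m-4*s*d1-4*e1*e4)*m+(s^2+e4)*e2+(s^2+e1)*e3 = s*d2+(s^2+m-4*s^2*m-4*s*d2-4*e2*e1)*e2+(s^2+e1)*(1-s^2)+(s^2+e2)*m := by linear_combination k13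
  have E23 : s*d2+(s^2+m-4*s^2*m-4*s*d2-4*e2*e1)*e2+(s^2+e1)*(1-s^2)+(s^2+e2)*m = s*d3+(s^2+m-4*s^2*m-4*s*d3-4*e3*e2)*(1-s^2)+(s^2+e2)*e3+(s^2+e3)*e2 := by linear_combination k23
  have E33 : s*d3+(s^2+m-4*s^2*m-4*s*d3-4*e3*e2)*(1-s^2)+(s^2+e2)*e3+(s^2+e3)*e2 = s*d4+(s^2+m-4*s^2*m-4*s*d4-4*e4*e3)*e3+(s^2+e3)*m+(s^2+e4)*(1-s^2) := by linear_combination k33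
  have E14 : s*d1+(s^2+m-4*s^2*m-4*s*d1-4*e1*e4)*e4+(s^2+e4)*m+(s^2+e1)*(1-s^2) = s*(d1+d3-d4)+(s^2+m-4*s^2*m-4*s*d2-4*e2*e1)*m+(s^2+e1)*e3+(s^2+e2)*e4 := by linear_combination k14
  have E24 : s*(d1+d3-d4)+(s^2+m-4*s^2*m-4*s*d2-4*e2*e1)*m+(s^2+e1)*e3+(s^2+e2)*e4 = s*d3+(s^2+m-4*s^2*m-4*s*d3-4*e3*e2)*e3+(s^2+e2)*(1-s^2)+(s^2+e3)*m := by linear_combination k24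
  have E34 : s*d3+(s^2+m-4*s^2*m-4*s*d3-4*e3*e2)*e3+(s^2+e2)*(1-s^2)+(s^2+e3)*m = s*d4+(s^2+m-4*s^2*m-4*s*d4-4*e4*e3)*(1-s^2)+(s^2+e3)*e4+(s^2+e4)*e3 := by linear_combination k34
  have F1 : s*(2*d1-d2-d4)+(s^2+m-4*s^2*m-4*s*d1-4*e1*e4)*(1-s^2)-(s^2+m-4*s^2*m-4*s*d3-4*e3*e2)*m+2*e1*e4-e1*e3-e2*e4 = 0 := by linear_combination E11 + E21
  have F2 : s*(2*d2-d3-d1)+(s^2+m-4*s^2*m-4*s*d2-4*e2*e1)*(1-s^2)-(s^2+m-4*s^2*m-4*s*d4-4*e4*e3)*m+2*e2*e1-e1*e3-e2*e4 = 0 := by linear_combination E22 + E32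
  have F3 : s*(2*d3-d4-d2)+(s^2+m-4*s^2*m-4*s*d3-4*e3*e2)*(1-s^2)-(s^2+m-4*s^2*m-4*s*d1-4*e1*e4)*m+2*e3*e2-e1*e3-e2*e4 = 0 := by linear_combination -E13 - E23
  have F4 : s*(2*d4-d1-d3)+(s^2+m-4*s^2*m-4*s*d4-4*e4*e3)*(1-s^2)-(s^2+m-4*s^2*m-4*s*d2-4*e2*e1)*m+2*e4*e3-e1*e3-e2*e4 = 0 := by linear_combination -E24 - E34
  have L1 : d3*(1-s^2)-d4*e1+d1*m-d2*e4 = 0 := by linear_combination l1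
  have L2 : d3*e1-d4*(1-s^2)+d1*e2-d2*m = 0 := by linear_combination l2
  have L3 : d3*m-d4*e2+d1*(1-s^2)-d2*e3 = 0 := by linear_combination l3
  have L4 : d3*e4-d4*m+d1*e3-d2*(1-s^2) = 0 := by linear_combination l4
  have G1 : d1^2 = (1-s^2)^3+2*e1*e4*m-(1-s^2)*(m^2+e1^2+e4^2) := by linear_combination g1
  have G2 : d2^2 = (1-s^2)^3+2*e2*e1*m-(1-s^2)*(m^2+e2^2+e1^2) := by linear_combination g2
  have G3 : d3^2 = (1-s^2)^3+2*e3*e2*m-(1-s^2)*(m^2+e3^2+e2^2) := by linear_combination g3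
  have G4 : d4^2 = (1-s^2)^3+2*e4*e3*m-(1-s^2)*(m^2+e4^2+e3^2) := by linear_combination g4
  exact case_main s e1 e2 e3 e4 m d1 d2 d3 d4 F1 F2 F3 F4 T1 T2 T3 T4 L1 L2 L3 L4 G1 G2 G3 G4 hA hB

theorem exists_mk (s : ℂ) (x : Matrix.SpecialLinearGroup (Fin 2) ℂ)
    (h : (x : Matrix (Fin 2) (Fin 2) ℂ).trace = 2*s) :
    ∃ v : V3, (x : Matrix (Fin 2) (Fin 2) ℂ) = mk s v ∧ dot v v = 1 - s^2 := by
  obtain ⟨x, hx⟩ := x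
  simp only [Matrix.trace_fin_two, Matrix.det_fin_two] at h hx
  refine ⟨⟨(x 0 0 - x 1 1)/2, x 0 1, x 1 0⟩, ?_, ?_⟩
  · ext i j
    fin_cases i <;> fin_cases j <;> simp [mk]
    · linear_combination h/2
    · linear_combination h/2
  · simp only [dot]
    linear_combination hx - (x 0 0 + x 1 1 + 2*s)/4*h

theorem trace_mk (s : ℂ) (u v : V3) : (mk s u * mk s v).trace = 2*s^2 - 2*dot u v := by
  simp [mk, dot, Matrix.trace_fin_two]
  ring

/-- Under the trace equations of the knot 8₁₈ with all triples
irreducible and `tr(xᵢxᵢ₊₁) ≠ 1`, if `tr(x₁x₃) = tr(x₂x₄)` then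
`(tr(x₁x₂) − tr(x₃x₄))(tr(x₁x₄) − tr(x₂x₃)) = 0`. -/
theorem stmt11 (t : ℂ) (x₁ x₂ x₃ x₄ : SL2)
    (hx₁ : ((x₁ : 𝕄)).trace = t) (hx₂ : ((x₂ : 𝕄)).trace = t)
    (hx₃ : ((x₃ : 𝕄)).trace = t) (hx₄ : ((x₄ : 𝕄)).trace = t)
    (hr₁₂ : x₁ * x₂ * x₁⁻¹ * x₄ * x₁ = x₂ * x₃ * x₂⁻¹ * x₁ * x₂)
    (hr₂₃ : x₂ * x₃ * x₂⁻¹ * x₁ * x₂ = x₃ * x₄ * x₃⁻¹ * x₂ * x₃)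
    (hr₃₄ : x₃ * x₄ * x₃⁻¹ * x₂ * x₃ = x₄ * x₁ * x₄⁻¹ * x₃ * x₄)
    (hirr₁₂₃ : IsIrreducibleFamily ![(x₁ : 𝕄), (x₂ : 𝕄), (x₃ : 𝕄)])
    (hirr₁₂₄ : IsIrreducibleFamily ![(x₁ : 𝕄), (x₂ : 𝕄), (x₄ : 𝕄)])
    (hirr₁₃₄ : IsIrreducibleFamily ![(x₁ : 𝕄), (x₃ : 𝕄), (x₄ : 𝕄)])
    (hirr₂₃₄ : IsIrreducibleFamily ![(x₂ : 𝕄), (x₃ : 𝕄), (x₄ : 𝕄)])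
    (ht₁₂ : ((x₁ * x₂ : SL2) : 𝕄).trace ≠ 1) (ht₂₃ : ((x₂ * x₃ : SL2) : 𝕄).trace ≠ 1)
    (ht₃₄ : ((x₃ * x₄ : SL2) : 𝕄).trace ≠ 1) (ht₄₁ : ((x₄ * x₁ : SL2) : 𝕄).trace ≠ 1)
    (h : ((x₁ * x₃ : SL2) : 𝕄).trace = ((x₂ * x₄ : SL2) : 𝕄).trace) :
    (((x₁ * x₂ : SL2) : 𝕄).trace - ((x₃ * x₄ : SL2) : 𝕄).trace) * (((x₁ * x₄ : SL2) : 𝕄).trace - ((x₂ * x₃ : SL2) : 𝕄).trace) = 0 := by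
  have ht : t = 2*(t/2) := by ring
  obtain ⟨v1, k1, n1⟩ := exists_mk (t/2) x₁ (hx₁.trans ht)
  obtain ⟨v2, k2, n2⟩ := exists_mk (t/2) x₂ (hx₂.trans ht)
  obtain ⟨v3, k3, n3⟩ := exists_mk (t/2) x₃ (hx₃.trans ht)
  obtain ⟨v4, k4, n4⟩ := exists_mk (t/2) x₄ (hx₄.trans ht)
  have r1 := congrArg (fun y : SL2 => (y : 𝕄)) hr₁₂
  have r2 := congrArg (fun y : SL2 => (y : 𝕄)) hr₂₃
  have r3 := congrArg (fun y : SL2 => (y : 𝕄)) hr₃₄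
  simp only [Matrix.SpecialLinearGroup.coe_mul, Matrix.SpecialLinearGroup.coe_inv,
    k1, k2, k3, k4] at r1 r2 r3
  simp only [Matrix.SpecialLinearGroup.coe_mul, k1, k2, k3, k4, trace_mk] at h ht₁₂ ht₂₃ ht₃₄ ht₄₁ ⊢
  rw [dot_comm' v1 v4]
  by_contra hne
  refine vec_main (t/2) v1 v2 v3 v4 n1 n2 n3 n4 (by linear_combination h/2) r1 r2 r3
    ht₁₂ ht₂₃ ht₃₄ ht₄₁ ?_ ?_
  · intro h0
    apply hne
    linear_combination (-2)*(2*(t/2)^2-2*dot v4 v1-(2*(t/2)^2-2*dot v2 v3))*h0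
  · intro h0
    apply hne
    linear_combination (-2)*(2*(t/2)^2-2*dot v1 v2-(2*(t/2)^2-2*dot v3 v4))*h0
end

section
/- Let t ∈ ℂ and let x₁, x₂, x₃, x₄ ∈ SL(2,ℂ) with tr(xᵢ) = t for all i, such that r₁ = r₂ = r₃ = r₄ where rᵢ = xᵢxᵢ₊₁xᵢ⁻¹xᵢ₋₁xᵢ (subscripts modulo 4), each of the triples (x₁,x₂,x₃), (x₁,x₂,x₄), (x₁,x₃,x₄), (x₂,x₃,x₄) is irreducible, tr(xᵢxᵢ₊₁) ≠ 1 for all i (subscripts modulo 4), and tr(x₁x₃) ≠ tr(x₂x₄). Then either (tr(x₁x₂) = tr(x₁x₄) and tr(x₃x₄) = tr(x₂x₃)), or (tr(x₁x₂) = tr(x₂x₃) and tr(x₃x₄) = tr(x₁x₄)). -/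
open Matrix

local notation "𝕄" => Matrix (Fin 2) (Fin 2) ℂ
local notation "SL2" => Matrix.SpecialLinearGroup (Fin 2) ℂ

lemma aux818 (t : ℂ) (x y z : SL2) (hx : (x : 𝕄).trace = t) (hy : (y : 𝕄).trace = t)
    (hz : (z : 𝕄).trace = t) :
    ((x * y * x⁻¹ * z * x * y⁻¹ : SL2) : 𝕄).trace
      + ((x * y : SL2) : 𝕄).trace * ((x * y * x⁻¹ * z * x * x⁻¹ : SL2) : 𝕄).trace
      = t ^ 2 - ((z * x : SL2) : 𝕄).trace + t * ((x * y * x⁻¹ * z * x : SL2) : 𝕄).trace ∧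
    ((x * y * x⁻¹ * z * x * z⁻¹ : SL2) : 𝕄).trace
      + ((z * x : SL2) : 𝕄).trace * ((x * y * x⁻¹ * z * x * x⁻¹ : SL2) : 𝕄).trace
      = t ^ 2 - ((x * y : SL2) : 𝕄).trace + t * ((x * y * x⁻¹ * z * x : SL2) : 𝕄).trace ∧
    ((y * z : SL2) : 𝕄).trace
      = (t ^ 2 - 1) * ((x * y * x⁻¹ * z * x * x⁻¹ : SL2) : 𝕄).trace
        - t * ((x * y * x⁻¹ * z * x : SL2) : 𝕄).trace
        + t ^ 2 * (((x * y : SL2) : 𝕄).trace + ((z * x : SL2) : 𝕄).trace) - t ^ 4 + t ^ 2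
        - ((x * y : SL2) : 𝕄).trace * ((z * x : SL2) : 𝕄).trace := by
  have e : x * y * x⁻¹ * z * x * x⁻¹ = x * y * x⁻¹ * z := by group
  rw [e]
  have dx := x.det_coe
  have dy := y.det_coe
  have dz := z.det_coe
  simp only [Matrix.SpecialLinearGroup.coe_mul, Matrix.SpecialLinearGroup.coe_inv,
    Matrix.adjugate_fin_two, Matrix.trace_fin_two, Matrix.det_fin_two, Matrix.mul_apply,
    Fin.sum_univ_two, Matrix.of_apply, Matrix.cons_val', Matrix.cons_val_zero,
    Matrix.cons_val_one, Matrix.cons_val_fin_one] at *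
  generalize (x : 𝕄) 0 0 = x1 at *
  generalize (x : 𝕄) 0 1 = x2 at *
  generalize (x : 𝕄) 1 0 = x3 at *
  generalize (x : 𝕄) 1 1 = x4 at *
  generalize (y : 𝕄) 0 0 = y1 at *
  generalize (y : 𝕄) 0 1 = y2 at *
  generalize (y : 𝕄) 1 0 = y3 at *
  generalize (y : 𝕄) 1 1 = y4 at *
  generalize (z : 𝕄) 0 0 = z1 at *
  generalize (z : 𝕄) 0 1 = z2 at *
  generalize (z : 𝕄) 1 0 = z3 at *
  generalize (z : 𝕄) 1 1 = z4 at *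
  clear e
  obtain rfl : x4 = t - x1 := by linear_combination hx
  obtain rfl : y4 = t - y1 := by linear_combination hy
  obtain rfl : z4 = t - z1 := by linear_combination hz
  clear hx hy hz
  refine ⟨?_, ?_, ?_⟩
  · grind
  · grind
  · grind

/-- The elimination argument. -/
lemma elim818 (t R R1 R2 R3 R4 a1 a2 a3 a4 e f : ℂ)
    (u1 : a1 ≠ 1) (u2 : a2 ≠ 1) (u3 : a3 ≠ 1) (u4 : a4 ≠ 1) (hef : e ≠ f)
    (A1 : R2 + a1 * R1 = t ^ 2 - a4 + t * R) (B4 : R4 + a4 * R1 = t ^ 2 - a1 + t * R)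
    (A2 : R3 + a2 * R2 = t ^ 2 - a1 + t * R) (B1 : R1 + a1 * R2 = t ^ 2 - a2 + t * R)
    (A3 : R4 + a3 * R3 = t ^ 2 - a2 + t * R) (B2 : R2 + a2 * R3 = t ^ 2 - a3 + t * R)
    (A4 : R1 + a4 * R4 = t ^ 2 - a3 + t * R) (B3 : R3 + a3 * R4 = t ^ 2 - a4 + t * R)
    (F1 : f = (t ^ 2 - 1) * R1 - t * R + t ^ 2 * (a1 + a4) - t ^ 4 + t ^ 2 - a1 * a4)
    (F2 : e = (t ^ 2 - 1) * R2 - t * R + t ^ 2 * (a2 + a1) - t ^ 4 + t ^ 2 - a2 * a1)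
    (F3 : f = (t ^ 2 - 1) * R3 - t * R + t ^ 2 * (a3 + a2) - t ^ 4 + t ^ 2 - a3 * a2)
    (F4 : e = (t ^ 2 - 1) * R4 - t * R + t ^ 2 * (a4 + a3) - t ^ 4 + t ^ 2 - a4 * a3) :
    (a1 = a4 ∧ a3 = a2) ∨ (a1 = a2 ∧ a3 = a4) := by
  have v1 : 1 - a1 ≠ 0 := fun h => u1 (by linear_combination -h)
  have v2 : 1 - a2 ≠ 0 := fun h => u2 (by linear_combination -h)
  have v3 : 1 - a3 ≠ 0 := fun h => u3 (by linear_combination -h)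
  have v4 : 1 - a4 ≠ 0 := fun h => u4 (by linear_combination -h)
  have D1 : R2 - R1 = (a2 - a4) / (1 - a1) := by
    rw [eq_div_iff v1]; linear_combination A1 - B1
  have D2 : R3 - R2 = (a3 - a1) / (1 - a2) := by
    rw [eq_div_iff v2]; linear_combination A2 - B2
  have D3 : R4 - R3 = (a4 - a2) / (1 - a3) := by
    rw [eq_div_iff v3]; linear_combination A3 - B3
  have D4 : R1 - R4 = (a1 - a3) / (1 - a4) := by
    rw [eq_div_iff v4]; linear_combination A4 - B4
  -- `G i = g(1 - aᵢ)`
  obtain ⟨G, hG⟩ : ∃ G : ℂ → ℂ, ∀ a, G a = (t ^ 2 - 1) * (1 + 1 / (1 - a)) + (1 - a) :=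
    ⟨_, fun _ => rfl⟩
  have E1 : e - f = (a2 - a4) * G a1 := by
    have : e - f = (t ^ 2 - 1) * (R2 - R1) + (t ^ 2 - a1) * (a2 - a4) := by
      linear_combination F2 - F1
    rw [this, D1, hG]; ring
  have E2 : f - e = (a3 - a1) * G a2 := by
    have : f - e = (t ^ 2 - 1) * (R3 - R2) + (t ^ 2 - a2) * (a3 - a1) := by
      linear_combination F3 - F2
    rw [this, D2, hG]; ring
  have E3 : e - f = (a4 - a2) * G a3 := by
    have : e - f = (t ^ 2 - 1) * (R4 - R3) + (t ^ 2 - a3) * (a4 - a2) := by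
      linear_combination F4 - F3
    rw [this, D3, hG]; ring
  have E4 : f - e = (a1 - a3) * G a4 := by
    have : f - e = (t ^ 2 - 1) * (R1 - R4) + (t ^ 2 - a4) * (a1 - a3) := by
      linear_combination F1 - F4
    rw [this, D4, hG]; ring
  have hef' : e - f ≠ 0 := sub_ne_zero.mpr hef
  have q0 : a2 - a4 ≠ 0 := by
    intro h; rw [h, zero_mul] at E1; exact hef' E1
  have p0 : a1 - a3 ≠ 0 := by
    intro h; rw [h, zero_mul] at E4; exact hef' (by linear_combination -E4)
  have S13 : G a1 + G a3 = 0 :=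
    mul_left_cancel₀ q0 (by linear_combination E3 - E1)
  have S24 : G a2 + G a4 = 0 :=
    mul_left_cancel₀ p0 (by linear_combination E2 - E4)
  have hP : (1 - a1) * (1 - a3) = (1 - a2) * (1 - a4) := by
    have s : (a2 - a4) / (1 - a1) + (a3 - a1) / (1 - a2) + (a4 - a2) / (1 - a3)
        + (a1 - a3) / (1 - a4) = 0 := by
      rw [← D1, ← D2, ← D3, ← D4]; ring
    field_simp at s
    apply mul_left_cancel₀ p0
    apply mul_left_cancel₀ q0
    linear_combination -s
  have H13 : 2 * (t ^ 2 - 1) * ((1 - a1) * (1 - a3))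
      + (2 - a1 - a3) * ((1 - a1) * (1 - a3) + (t ^ 2 - 1)) = 0 := by
    rw [hG, hG] at S13
    field_simp at S13
    linear_combination S13
  have H24 : 2 * (t ^ 2 - 1) * ((1 - a2) * (1 - a4))
      + (2 - a2 - a4) * ((1 - a2) * (1 - a4) + (t ^ 2 - 1)) = 0 := by
    rw [hG, hG] at S24
    field_simp at S24
    linear_combination S24
  rw [← hP] at H24
  have hsum : a1 + a3 = a2 + a4 := by
    have h0 : (a2 + a4 - a1 - a3) * ((1 - a1) * (1 - a3) + (t ^ 2 - 1)) = 0 := by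
      linear_combination H13 - H24
    rcases mul_eq_zero.mp h0 with h0 | h0
    · linear_combination -h0
    · exfalso
      rw [h0, mul_zero, add_zero] at H13
      have hne : (1 - a1) * (1 - a3) ≠ 0 := mul_ne_zero v1 v3
      have ht : t ^ 2 - 1 = 0 := by
        rcases mul_eq_zero.mp H13 with h | h
        · simpa using h
        · exact absurd h hne
      exact hne (by linear_combination h0 - ht)
  have hfin : (a1 - a4) * (a1 - a2) = 0 := by
    linear_combination (a1 - 1) * hsum - hP
  rcases mul_eq_zero.mp hfin with h | h
  · exact Or.inl ⟨by linear_combination h, by linear_combination hsum - h⟩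
  · exact Or.inr ⟨by linear_combination h, by linear_combination hsum - h⟩

/-- Under the trace equations of 8₁₈ with all triples irreducible,
`tr(xᵢxᵢ₊₁) ≠ 1`, and `tr(x₁x₃) ≠ tr(x₂x₄)`, either `t₁₂ = t₁₄ ∧ t₃₄ = t₂₃`
or `t₁₂ = t₂₃ ∧ t₃₄ = t₁₄`. -/
theorem stmt12 (t : ℂ) (x₁ x₂ x₃ x₄ : SL2)
    (hx₁ : ((x₁ : 𝕄)).trace = t) (hx₂ : ((x₂ : 𝕄)).trace = t)
    (hx₃ : ((x₃ : 𝕄)).trace = t) (hx₄ : ((x₄ : 𝕄)).trace = t)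
    (hr₁₂ : x₁ * x₂ * x₁⁻¹ * x₄ * x₁ = x₂ * x₃ * x₂⁻¹ * x₁ * x₂)
    (hr₂₃ : x₂ * x₃ * x₂⁻¹ * x₁ * x₂ = x₃ * x₄ * x₃⁻¹ * x₂ * x₃)
    (hr₃₄ : x₃ * x₄ * x₃⁻¹ * x₂ * x₃ = x₄ * x₁ * x₄⁻¹ * x₃ * x₄)
    (hirr₁₂₃ : IsIrreducibleFamily ![(x₁ : 𝕄), (x₂ : 𝕄), (x₃ : 𝕄)])
    (hirr₁₂₄ : IsIrreducibleFamily ![(x₁ : 𝕄), (x₂ : 𝕄), (x₄ : 𝕄)])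
    (hirr₁₃₄ : IsIrreducibleFamily ![(x₁ : 𝕄), (x₃ : 𝕄), (x₄ : 𝕄)])
    (hirr₂₃₄ : IsIrreducibleFamily ![(x₂ : 𝕄), (x₃ : 𝕄), (x₄ : 𝕄)])
    (ht₁₂ : ((x₁ * x₂ : SL2) : 𝕄).trace ≠ 1) (ht₂₃ : ((x₂ * x₃ : SL2) : 𝕄).trace ≠ 1)
    (ht₃₄ : ((x₃ * x₄ : SL2) : 𝕄).trace ≠ 1) (ht₄₁ : ((x₄ * x₁ : SL2) : 𝕄).trace ≠ 1)
    (h : ((x₁ * x₃ : SL2) : 𝕄).trace ≠ ((x₂ * x₄ : SL2) : 𝕄).trace) :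
    (((x₁ * x₂ : SL2) : 𝕄).trace = ((x₁ * x₄ : SL2) : 𝕄).trace ∧ ((x₃ * x₄ : SL2) : 𝕄).trace = ((x₂ * x₃ : SL2) : 𝕄).trace) ∨
    (((x₁ * x₂ : SL2) : 𝕄).trace = ((x₂ * x₃ : SL2) : 𝕄).trace ∧ ((x₃ * x₄ : SL2) : 𝕄).trace = ((x₁ * x₄ : SL2) : 𝕄).trace) := by
  have c (x y : SL2) : ((x * y : SL2) : 𝕄).trace = ((y * x : SL2) : 𝕄).trace := by
    rw [Matrix.SpecialLinearGroup.coe_mul, Matrix.SpecialLinearGroup.coe_mul, Matrix.trace_mul_comm]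
  obtain ⟨A1, B4, F1⟩ := aux818 t x₁ x₂ x₄ hx₁ hx₂ hx₄
  obtain ⟨A2, B1, F2⟩ := aux818 t x₂ x₃ x₁ hx₂ hx₃ hx₁
  obtain ⟨A3, B2, F3⟩ := aux818 t x₃ x₄ x₂ hx₃ hx₄ hx₂
  obtain ⟨A4, B3, F4⟩ := aux818 t x₄ x₁ x₃ hx₄ hx₁ hx₃
  rw [← hr₃₄, ← hr₂₃, ← hr₁₂] at A4 B3 F4
  rw [← hr₂₃, ← hr₁₂] at A3 B2 F3
  rw [← hr₁₂] at A2 B1 F2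
  rw [c x₄ x₂] at F3
  rw [c x₃ x₁] at F2
  rw [c x₁ x₄]
  exact elim818 t _ _ _ _ _ _ _ _ _ _ _ ht₁₂ ht₂₃ ht₃₄ ht₄₁ h
    A1 B4 A2 B1 A3 B2 A4 B3 F1 F2 F3 F4
end

section
/- Let t ∈ ℂ and let x₁, x₂, x₃, x₄ ∈ SL(2,ℂ) with tr(xᵢ) = t for all i, such that r₁ = r₂ = r₃ = r₄ where rᵢ = xᵢxᵢ₊₁xᵢ⁻¹xᵢ₋₁xᵢ (subscripts modulo 4), each of the triples (x₁,x₂,x₃), (x₁,x₂,x₄), (x₁,x₃,x₄), (x₂,x₃,x₄) is irreducible, tr(xᵢxᵢ₊₁) ≠ 1 for all i (subscripts modulo 4), tr(x₁x₃) ≠ tr(x₂x₄), tr(x₁x₄) = tr(x₁x₂), and tr(x₃x₄) = tr(x₂x₃). Then t² ≠ 1. -/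
open Matrix

local notation "𝕄" => Matrix (Fin 2) (Fin 2) ℂ
local notation "SL2" => Matrix.SpecialLinearGroup (Fin 2) ℂ

theorem fin_two_ext {a b c d a' b' c' d' : ℂ} (h : !![a,b;c,d] = !![a',b';c',d']) :
    a = a' ∧ b = b' ∧ c = c' ∧ d = d' :=
  ⟨congrFun (congrFun h 0) 0, congrFun (congrFun h 0) 1, congrFun (congrFun h 1) 0,
    congrFun (congrFun h 1) 1⟩

theorem caseA_one (w e f g h k : ℂ) (hw : w^2 = w-1) (hhk : h*k = g-g^2-1) (hf : f^2=e-e^2-1)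
    (H : !![w,0;0,1-w] * !![g,h;k,1-g] * !![1-w,0;0,w] * !![g,k;h,1-g] * !![w,0;0,1-w]
      = !![g,h;k,1-g] * !![e,f;f,1-e] * !![1-g,-h;-k,g] * !![w,0;0,1-w] * !![g,h;k,1-g])
    (ha : w*g+(1-w)*(1-g) ≠ 1) :
    ((w*g+(1-w)*(1-g))-(e*g+f*h+f*k+(1-e)*(1-g)))*((w*g+(1-w)*(1-g))-1)
      = (w*e+(1-w)*(1-e))-(g^2+h^2+k^2+(1-g)^2) := by
  simp only [Matrix.mul_fin_two] at H
  obtain ⟨h1, h2, h3, h4⟩ := fin_two_ext H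
  clear H
  obtain ⟨z, hz⟩ : ∃ z, ((w*g+(1-w)*(1-g))-1)*z = 1 := ⟨_, mul_inv_cancel₀ (sub_ne_zero.2 ha)⟩
  clear ha
  grind (ringSteps := 1000000)

theorem alg_final (y c M : ℂ) (hy : y ≠ 0)
 (h1 : 3*(y+2)*M = -4*y^2-y-y*c+4)
 (k5 : -3*M*y^2 + 1 - y - c^2 +2*y^2*c+2*y*c -4*y^3 - y*c^2 +2*y^3*c = 0)
 (k2 : 3*M*((y+1)*c-1-3*y) = y*(2*c + 2*y^2 -6+3*y + y*c -2*y^3))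
 (h7 : (c-1)*(-(c-3)*(c+1)+2*y^2*(c-2))=0)
 : y^2+2*y+2=0 := by
  obtain ⟨z, hz⟩ : ∃ z, y*z = 1 := ⟨_, mul_inv_cancel₀ hy⟩
  rcases mul_eq_zero.1 h7 with h | h
  · exfalso
    clear h7 hy
    grind (ringSteps := 1000000)
  · clear h7 hy
    have : 2*z^2+2*z+1=0 := by grind (ringSteps := 1000000)
    linear_combination y^2*this - (2*y*z+2*y+2)*hz

set_option maxRecDepth 20000 in
set_option maxHeartbeats 4000000 in
theorem caseA_two (s f m n y c w g h k e : ℂ) (hs : s^2 = -3)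
   (hw : w = (1+s)/2) (hg : g = 1/2 - s*(y+1/2)/3) (he : e = 1/2 - s*(c-1/2)/3)
   (hh : h = (m+n)/2) (hk : k = (m-n)/2)
   (hf2 : f^2 = c^2/3-c/3-2/3) (hm2 : m^2 = -2*y^2/3+4*y/3+c-5/3) (hn2 : n^2 = -2*y^2+c+1)
   (hfm : f*m = 2*y*c/3-4*y/3+c/3+1/3)
   (H : !![w,0;0,1-w] * !![g,h;k,1-g] * !![1-w,0;0,w] * !![g,k;h,1-g] * !![w,0;0,1-w]
      = !![g,h;k,1-g] * !![e,f;f,1-e] * !![1-g,-h;-k,g] * !![w,0;0,1-w] * !![g,h;k,1-g])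
   (H' : !![1-g,-h;-k,g] * !![w,0;0,1-w] * !![g,h;k,1-g] * !![1-w,0;0,w] * !![g,k;h,1-g] * !![w,0;0,1-w] * !![1-g,-h;-k,g]
      = !![e,f;f,1-e] * !![1-g,-h;-k,g] * !![w,0;0,1-w]) (hy : y ≠ 0) : y^2+2*y+2=0 := by
  simp only [Matrix.mul_fin_two] at H H'
  obtain ⟨a1, a2, a3, a4⟩ := fin_two_ext H
  obtain ⟨b1, b2, b3, b4⟩ := fin_two_ext H'
  clear H H'
  subst hw hg he hh hk
  have e1 : 3*(s*f*n+s*(y+1)*m*n) = 3*(2*y^2+y*c-y) := by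
    linear_combination ((-6))*(b1 + b4)
      + ((-1/54)*s^4*y^4 + (-1/27)*s^4*y^3 + (-1/36)*s^4*y^2 + (-1/108)*s^4*y + (-1/864)*s^4 + (1/12)*s^3*m*n*y^2 + (1/12)*s^3*m*n*y + (1/48)*s^3*m*n + (1/12)*s^2*m^2*y^2 + (7/12)*s^2*m^2*y + (13/48)*s^2*m^2 + (1/6)*s^2*n^2*y^2 + (1/6)*s^2*n^2*y + (1/24)*s^2*n^2 + (2/27)*s^2*y^4 + (4/27)*s^2*y^3 + (7/36)*s^2*y^2 + (13/108)*s^2*y + (11/432)*s^2 + (3/16)*s*m^3*n + (-3/16)*s*m*n^3 + (1)*s*m*n*y + (17/16)*s*m*n + (9/32)*m^4 + (-1/6)*m^2*y^2 + (-5/3)*m^2*y + (-11/48)*m^2 + (-9/32)*n^4 + (-1/2)*n^2*y^2 + (1/2)*n^2 + (-2/9)*y^4 + (-4/9)*y^3 + (-2/3)*y^2 + (2/3)*y*c + (-16/9)*y + (4/3)*c + (-391/288))*hs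
      + ((-3/4)*m^2 + (1)*y^2 + (4)*y + (-3/4)*c + (7/4))*hm2
      + ((3/4)*n^2 + (3/4)*c + (-3/4))*hn2
      + ((3))*hfm
  have e2 : s*(2*y^3-y*c-3*y) = 3*(y+1)*f*n + 3*m*n := by
    linear_combination ((3))*(a1 - a4)
      + ((-1/27)*s^3*y^3*c + (1/54)*s^3*y^3 + (-1/18)*s^3*y^2*c + (1/9)*s^3*y^2 + (-1/36)*s^3*y*c + (7/72)*s^3*y + (-1/216)*s^3*c + (5/216)*s^3 + (-1/2)*s*f*m*y^2 + (-1/2)*s*f*m*y + (-1/8)*s*f*m + (1/4)*s*m^2*y*c + (-1/8)*s*m^2*y + (1/8)*s*m^2*c + (-1/4)*s*m^2 + (-1/4)*s*n^2*y*c + (1/8)*s*n^2*y + (-1/8)*s*n^2*c + (-1/8)*s*n^2 + (1/9)*s*y^3*c + (2/9)*s*y^2*c + (-4/9)*s*y^2 + (2/9)*s*y*c + (-53/72)*s*y + (5/72)*s*c + (-5/72)*s + (-1/6)*f*n*y^2 + (-7/6)*f*n*y + (-13/24)*f*n + (-9/8)*m*n)*hs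
      + ((3/8)*s*f*m + (-3/4)*s*y*c + (1/2)*s*y + (-1/4)*s*c + (-3/8)*f*n)*hm2
      + ((-3/8)*s*f*m + (3/4)*s*y*c + (-1/2)*s*y + (1/4)*s*c + (3/8)*f*n)*hn2
      + ((2)*s*y^2 + (2)*s*y + (-1)*s)*hfm
  have k5 : s*m*n*y^2 + 1 - y - c^2 +2*y^2*c+2*y*c -4*y^3 - y*c^2 +2*y^3*c = 0 := by
    linear_combination ((-1)*s*m)*(a2 - a3)
      + ((-1/18)*s^3*m*n*y^2*c + (1/36)*s^3*m*n*y^2 + (-1/18)*s^3*m*n*y*c + (1/36)*s^3*m*n*y + (-1/72)*s^3*m*n*c + (1/144)*s^3*m*n + (-1/27)*s^2*f*m*y^3 + (-1/9)*s^2*f*m*y^2 + (-1/12)*s^2*f*m*y + (-1/54)*s^2*f*m + (1/54)*s^2*m^2*y^2*c + (1/54)*s^2*m^2*y^2 + (1/54)*s^2*m^2*y*c + (1/54)*s^2*m^2*y + (1/216)*s^2*m^2*c + (1/216)*s^2*m^2 + (-1/3)*s*f*m^2*n*y + (-1/6)*s*f*m^2*n + (1/24)*s*m^3*n*c + (-1/48)*s*m^3*n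 + (-1/24)*s*m*n^3*c + (1/48)*s*m*n^3 + (1/6)*s*m*n*y^2*c + (-1/18)*s*m*n*y^2 + (1/6)*s*m*n*y*c + (-1/18)*s*m*n*y + (1/6)*s*m*n*c + (-11/144)*s*m*n + (-1/12)*f*m^3*y + (-1/6)*f*m^3 + (1/12)*f*m*n^2*y + (-1/3)*f*m*n^2 + (1/9)*f*m*y^3 + (1/3)*f*m*y^2 + (1/3)*f*m*y + (2/9)*f*m + (1/24)*m^4*c + (1/24)*m^4 + (-1/24)*m^2*n^2*c + (-1/24)*m^2*n^2 + (-1/18)*m^2*y^2*c + (-1/18)*m^2*y^2 + (-1/18)*m^2*y*c + (-1/18)*m^2*y + (-1/18)*m^2*c + (-1/18)*m^2)*hs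
      + ((-1/8)*s*m*n*c + (1/8)*s*m*n + (1/4)*f*m*y + (1/2)*f*m + (-1/8)*m^2*c + (-1/8)*m^2 + (1/8)*n^2*c + (1/8)*n^2 + (1/4)*y^2*c + (1/4)*y^2 + (-1/8)*c^2 + (1/4)*c + (3/8))*hm2
      + ((1/8)*s*m*n*c + (-1/8)*s*m*n + (-1/4)*f*m*y + (1)*f*m + (-1/12)*y^2*c + (-1/12)*y^2 + (1/6)*y*c + (1/6)*y + (1/8)*c^2 + (-1/12)*c + (-5/24))*hn2
      + ((1)*s*m*n*y + (1/2)*s*m*n + (-3)*y^2 + (-1)*y + (3/2)*c + (-1/2))*hfm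
  have k2 : -s*m*n*((y+1)*c-1-3*y) = y*(2*c + 2*y^2 -6+3*y + y*c -2*y^3) := by
    linear_combination ((3)*m)*(a2 + a3)
      + ((-1/9)*s^2*f*m*y^3 + (-1/6)*s^2*f*m*y^2 + (-1/12)*s^2*f*m*y + (-1/72)*s^2*f*m + (1/6)*s^2*m^2*y^2*c + (-1/12)*s^2*m^2*y^2 + (1/6)*s^2*m^2*y*c + (1/6)*s^2*m^2*y + (1/24)*s^2*m^2*c + (5/48)*s^2*m^2 + (-1/18)*s*m*n*y^2*c + (-1/18)*s*m*n*y^2 + (-1/18)*s*m*n*y*c + (7/36)*s*m*n*y + (-1/72)*s*m*n*c + (35/72)*s*m*n + (3/4)*f*m^3*y + (3/8)*f*m^3 + (1/4)*f*m*n^2*y + (1/8)*f*m*n^2 + (1/3)*f*m*y^3 + (1/3)*f*m*y^2 + (1/3)*f*m*y + (1/8)*f*m + (-1/8)*m^4*c + (1/16)*m^4 + (1/8)*m^2*n^2*c + (-1/16)*m^2*n^2 + (-1/2)*m^2*y^2*c + (1/6)*m^2*y^2 + (-1/2)*m^2*y*c + (-5/6)*m^2*y + (-1/2)*m^2*c +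 (5/48)*m^2)*hs
      + ((-1/8)*s*m*n*c + (-1/8)*s*m*n + (-9/4)*f*m*y + (-3/2)*f*m + (3/8)*m^2*c + (-3/8)*m^2 + (-3/8)*n^2*c + (3/8)*n^2 + (5/4)*y^2*c + (-1/4)*y^2 + (2)*y*c + (2)*y + (3/8)*c^2 + (1/2)*c + (1/8))*hm2
      + ((1/8)*s*m*n*c + (1/8)*s*m*n + (-3/4)*f*m*y + (1/4)*y^2*c + (-1/4)*y^2 + (-1/2)*y*c + (1/2)*y + (-3/8)*c^2 + (1)*c + (-5/8))*hn2
      + ((3/2)*s*m*n + (2)*y^3 + (-3)*y^2 + (-3)*y*c + (-3/2)*c + (5/2))*hfm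
  clear a1 a2 a3 a4 b1 b2 b3 b4
  apply alg_final y c (-s*m*n/3) hy
  · apply mul_left_cancel₀ hy
    linear_combination (-1/3)*(y+1)*e1 - s/3*e2 + (2*y^3-y*c-3*y)/3*hs
  · linear_combination k5
  · linear_combination k2
  · linear_combination 3*m^2*hf2 + 3*(c^2/3-c/3-2/3)*hm2 - 3*(f*m+(2*y*c/3-4*y/3+c/3+1/3))*hfm

theorem caseC (w e p q g h k : ℂ) (hw : w^2 = w-1) (hhk : h*k = g-g^2-1) (hf : p*q=e-e^2-1)
    (hh : h ≠ 0) (hk : k ≠ 0)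
    (H : !![w,0;0,1-w] * !![g,h;k,1-g] * !![1-w,0;0,w] * !![g,h;k,1-g] * !![w,0;0,1-w]
      = !![g,h;k,1-g] * !![e,p;q,1-e] * !![1-g,-h;-k,g] * !![w,0;0,1-w] * !![g,h;k,1-g])
    (H' : !![e,p;q,1-e] * !![1-g,-h;-k,g] * !![w,0;0,1-w]
      = !![w,0;0,1-w] * !![1-g,-h;-k,g] * !![e,p;q,1-e]) :
    w*e+(1-w)*(1-e) = -1 := by
  simp only [Matrix.mul_fin_two] at H H'
  obtain ⟨h1, h2, h3, h4⟩ := fin_two_ext H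
  obtain ⟨k1, k2, k3, k4⟩ := fin_two_ext H'
  clear H H'
  obtain ⟨y, hy⟩ : ∃ z, h*z = 1 := ⟨_, mul_inv_cancel₀ hh⟩
  obtain ⟨z, hz⟩ : ∃ z, k*z = 1 := ⟨_, mul_inv_cancel₀ hk⟩
  clear hh hk
  grind (ringSteps := 1000000)

/-- The normalised (trace one) data used in the proof. -/
structure Good (x y z u : Matrix (Fin 2) (Fin 2) ℂ) : Prop where
  d1 : x.det = 1
  d2 : y.det = 1
  d3 : z.det = 1
  d4 : u.det = 1
  t1 : x.trace = 1
  t2 : y.trace = 1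
  t3 : z.trace = 1
  t4 : u.trace = 1
  R : x * y * (1 - x) * u * x = y * z * (1 - y) * x * y
  S : y * z * (1 - y) * x * y = u * x * (1 - u) * z * u
  T : (x * u).trace = (x * y).trace
  U : (z * u).trace = (z * y).trace
  I : ∀ v : Fin 2 → ℂ, v ≠ 0 → ∀ a b c : ℂ,
    x.mulVec v = a • v → y.mulVec v = b • v → z.mulVec v = c • v → False
  J : ∀ v : Fin 2 → ℂ, v ≠ 0 → ∀ a b c : ℂ,
    x.mulVec v = a • v → y.mulVec v = b • v → u.mulVec v = c • v → False

/-- The conclusion of the key lemma. -/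
def Concl (x y z u : Matrix (Fin 2) (Fin 2) ℂ) : Prop :=
  (x * y).trace ≠ 1 → (x * z).trace ≠ (y * u).trace →
    ((x * y).trace - (z * y).trace) * ((x * y).trace - 1) = (x * z).trace - (y * u).trace ∧
    ((x * y).trace + (z * y).trace = 2 → (x * y).trace ^ 2 + 1 = 0)

theorem cj_mul {P Q : Matrix (Fin 2) (Fin 2) ℂ} (h : P * Q = 1) (a b : Matrix (Fin 2) (Fin 2) ℂ) :
    (Q * a * P) * (Q * b * P) = Q * (a * b) * P := by
  calc (Q * a * P) * (Q * b * P) = Q * a * (P * Q) * b * P := by simp only [mul_assoc]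
    _ = _ := by rw [h]; simp only [mul_assoc, one_mul]

theorem conj_sub {P Q : Matrix (Fin 2) (Fin 2) ℂ} (h' : Q * P = 1) (a : Matrix (Fin 2) (Fin 2) ℂ) :
    1 - (Q * a * P) = Q * (1 - a) * P := by
  rw [mul_sub, sub_mul, mul_one, h']

theorem conj_tr {P Q : Matrix (Fin 2) (Fin 2) ℂ} (h : P * Q = 1) (a : Matrix (Fin 2) (Fin 2) ℂ) :
    (Q * a * P).trace = a.trace := by
  rw [mul_assoc, Matrix.trace_mul_comm, mul_assoc, h, mul_one]

theorem conj_det {P Q : Matrix (Fin 2) (Fin 2) ℂ} (h : P * Q = 1) (a : Matrix (Fin 2) (Fin 2) ℂ) :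
    (Q * a * P).det = a.det := by
  have := congrArg Matrix.det h
  rw [Matrix.det_mul, Matrix.det_one] at this
  rw [Matrix.det_mul, Matrix.det_mul]
  linear_combination a.det * this

theorem conj_ev {P Q : Matrix (Fin 2) (Fin 2) ℂ} (h : P * Q = 1) (x : Matrix (Fin 2) (Fin 2) ℂ)
    (v : Fin 2 → ℂ) (a : ℂ) (hv : (Q * x * P).mulVec v = a • v) :
    x.mulVec (P.mulVec v) = a • P.mulVec v := by
  have := congrArg P.mulVec hv
  rw [Matrix.mulVec_mulVec, Matrix.mulVec_smul] at this
  rw [← this, Matrix.mulVec_mulVec]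
  congr 1
  rw [← mul_assoc, ← mul_assoc, h, one_mul]

theorem conj_ne {P Q : Matrix (Fin 2) (Fin 2) ℂ} (h' : Q * P = 1)
    (v : Fin 2 → ℂ) (hv : v ≠ 0) : P.mulVec v ≠ 0 := by
  intro h0
  apply hv
  have := congrArg Q.mulVec h0
  rwa [Matrix.mulVec_mulVec, h', Matrix.one_mulVec, Matrix.mulVec_zero] at this

theorem Good.conj {x y z u : Matrix (Fin 2) (Fin 2) ℂ} (G : Good x y z u)
    (P Q : Matrix (Fin 2) (Fin 2) ℂ) (h : P * Q = 1) (h' : Q * P = 1) :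
    Good (Q * x * P) (Q * y * P) (Q * z * P) (Q * u * P) where
  d1 := by rw [conj_det h, G.d1]
  d2 := by rw [conj_det h, G.d2]
  d3 := by rw [conj_det h, G.d3]
  d4 := by rw [conj_det h, G.d4]
  t1 := by rw [conj_tr h, G.t1]
  t2 := by rw [conj_tr h, G.t2]
  t3 := by rw [conj_tr h, G.t3]
  t4 := by rw [conj_tr h, G.t4]
  R := by simp only [cj_mul h, conj_sub h', G.R]
  S := by simp only [cj_mul h, conj_sub h', G.S]
  T := by simp only [cj_mul h, conj_tr h, G.T]
  U := by simp only [cj_mul h, conj_tr h, G.U]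
  I := fun v hv a b c ha hb hc =>
    G.I _ (conj_ne h' v hv) a b c (conj_ev h _ _ _ ha) (conj_ev h _ _ _ hb) (conj_ev h _ _ _ hc)
  J := fun v hv a b c ha hb hc =>
    G.J _ (conj_ne h' v hv) a b c (conj_ev h _ _ _ ha) (conj_ev h _ _ _ hb) (conj_ev h _ _ _ hc)

theorem Concl.of_conj {x y z u : Matrix (Fin 2) (Fin 2) ℂ}
    (P Q : Matrix (Fin 2) (Fin 2) ℂ) (h : P * Q = 1)
    (C : Concl (Q * x * P) (Q * y * P) (Q * z * P) (Q * u * P)) : Concl x y z u := by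
  unfold Concl at C ⊢
  simpa only [cj_mul h, conj_tr h] using C

theorem one_sub_form (a b c : ℂ) :
    (1 : Matrix (Fin 2) (Fin 2) ℂ) - !![a, b; c, 1 - a] = !![1 - a, -b; -c, a] := by
  ext i j
  fin_cases i <;> fin_cases j <;> simp

theorem inv_form (a b c : ℂ) (h : b * c = a - a ^ 2 - 1) :
    !![1 - a, -b; -c, a] * !![a, b; c, 1 - a] = (1 : Matrix (Fin 2) (Fin 2) ℂ) ∧
    !![a, b; c, 1 - a] * !![1 - a, -b; -c, a] = (1 : Matrix (Fin 2) (Fin 2) ℂ) := by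
  rw [Matrix.mul_fin_two, Matrix.mul_fin_two, Matrix.one_fin_two]
  constructor
  · ext i j
    fin_cases i <;> fin_cases j <;> simp <;> first | ring1 | linear_combination -h
  · ext i j
    fin_cases i <;> fin_cases j <;> simp <;> first | ring1 | linear_combination -h

theorem coreC (w e p q g h k : ℂ) (hw : w^2 = w-1)
    (G : Good !![w,0;0,1-w] !![g,h;k,1-g] !![e,p;q,1-e] !![g,h;k,1-g]) :
    Concl !![w,0;0,1-w] !![g,h;k,1-g] !![e,p;q,1-e] !![g,h;k,1-g] := by
  intro ha hc
  exfalso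
  have d2 := G.d2
  have d3 := G.d3
  rw [Matrix.det_fin_two_of] at d2 d3
  have hhk : h*k = g-g^2-1 := by linear_combination -d2
  have hpq : p*q = e-e^2-1 := by linear_combination -d3
  have hh : h ≠ 0 := by
    rintro rfl
    refine G.J ![0,1] (by simp) (1-w) (1-g) (1-g) ?_ ?_ ?_ <;> ext i <;> fin_cases i <;> simp
  have hk : k ≠ 0 := by
    rintro rfl
    refine G.J ![1,0] (by simp) w g g ?_ ?_ ?_ <;> ext i <;> fin_cases i <;> simp
  have R := G.R
  have S := G.S
  simp only [one_sub_form, neg_zero] at R S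
  obtain ⟨i1, i2⟩ := inv_form g h k hhk
  apply hc
  have := caseC w e p q g h k hw hhk hpq hh hk R ?_
  · simp only [Matrix.mul_fin_two, Matrix.trace_fin_two_of]
    linear_combination this - 2*hhk
  · generalize !![1-g,-h;-k,g] = Y' at *
    generalize !![g,h;k,1-g] = Y at *
    generalize !![w,0;0,1-w] = X at *
    generalize !![e,p;q,1-e] = Z at *
    calc Z * Y' * X = (Y' * Y) * Z * Y' * X * (Y * Y') := by rw [i1, i2]; simp
      _ = Y' * (Y * Z * Y' * X * Y) * Y' := by simp only [mul_assoc]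
      _ = (Y' * Y) * X * Y' * Z * (Y * Y') := by rw [S]; simp only [mul_assoc]
      _ = _ := by rw [i1, i2]; simp

theorem coreA (w e f g h k : ℂ) (hw : w^2 = w-1)
    (G : Good !![w,0;0,1-w] !![g,h;k,1-g] !![e,f;f,1-e] !![g,k;h,1-g]) :
    Concl !![w,0;0,1-w] !![g,h;k,1-g] !![e,f;f,1-e] !![g,k;h,1-g] := by
  intro ha hc
  have d2 := G.d2
  have d3 := G.d3
  rw [Matrix.det_fin_two_of] at d2 d3
  have hhk : h*k = g-g^2-1 := by linear_combination -d2
  have hff : f^2 = e-e^2-1 := by linear_combination -d3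
  have R := G.R
  simp only [one_sub_form, neg_zero] at R
  obtain ⟨i1, i2⟩ := inv_form g h k hhk
  have R' : !![1-g,-h;-k,g] * !![w,0;0,1-w] * !![g,h;k,1-g] * !![1-w,0;0,w] * !![g,k;h,1-g] * !![w,0;0,1-w] * !![1-g,-h;-k,g]
      = !![e,f;f,1-e] * !![1-g,-h;-k,g] * !![w,0;0,1-w] := by
    generalize !![1-g,-h;-k,g] = Y' at *
    generalize !![g,h;k,1-g] = Y at *
    generalize !![w,0;0,1-w] = X at *
    generalize !![e,f;f,1-e] = Z at *
    generalize !![g,k;h,1-g] = U at *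
    generalize !![1-w,0;0,w] = X' at *
    calc Y' * X * Y * X' * U * X * Y' = Y' * (X * Y * X' * U * X) * Y' := by simp only [mul_assoc]
      _ = (Y' * Y) * Z * Y' * X * (Y * Y') := by rw [R]; simp only [mul_assoc]
      _ = _ := by rw [i1, i2]; simp
  simp only [Matrix.mul_fin_two, Matrix.trace_fin_two_of] at ha hc ⊢
  have ha' : w*g+(1-w)*(1-g) ≠ 1 := by
    intro h0; apply ha; linear_combination h0
  have h1 := caseA_one w e f g h k hw hhk hff R ha'
  refine ⟨by linear_combination h1, ?_⟩
  intro hab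
  have hb : e*g+f*h+f*k+(1-e)*(1-g) = 2 - (w*g+(1-w)*(1-g)) := by linear_combination hab
  rw [hb] at h1
  have key := caseA_two (2*w-1) f (h+k) (h-k) (w*g+(1-w)*(1-g)-1) (w*e+(1-w)*(1-e)) w g h k e
    (by linear_combination 4*hw) (by ring)
    (by linear_combination (2*(2*g-1)/3)*hw) (by linear_combination (2*(2*e-1)/3)*hw)
    (by ring) (by ring) (by linear_combination hff - (2*e-1)^2/3*hw)
    (by linear_combination h1 + 2*hhk - 4/3*(2*g-1)^2*hw) (by linear_combination h1 - 2*hhk)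
    (by linear_combination hb - 2/3*(2*e-1)*(2*g-1)*hw) R R' (sub_ne_zero.2 ha')
  linear_combination key

theorem coreScale (w e p q g h k h' k' l : ℂ) (hl : l ≠ 0)
    (C : Good !![w,0;0,1-w] !![g,l⁻¹*h;k*l,1-g] !![e,l⁻¹*p;q*l,1-e] !![g,l⁻¹*h';k'*l,1-g] → 
     Concl !![w,0;0,1-w] !![g,l⁻¹*h;k*l,1-g] !![e,l⁻¹*p;q*l,1-e] !![g,l⁻¹*h';k'*l,1-g])
    (G : Good !![w,0;0,1-w] !![g,h;k,1-g] !![e,p;q,1-e] !![g,h';k',1-g]) :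
    Concl !![w,0;0,1-w] !![g,h;k,1-g] !![e,p;q,1-e] !![g,h';k',1-g] := by
  have h1 : !![l,0;0,1] * !![l⁻¹,0;0,1] = 1 := by
    rw [Matrix.mul_fin_two, Matrix.one_fin_two]; simp [hl]
  have h2 : !![l⁻¹,0;0,1] * !![l,0;0,1] = 1 := by
    rw [Matrix.mul_fin_two, Matrix.one_fin_two]; simp [hl]
  have h3 : ∀ a b c d : ℂ, !![l⁻¹,0;0,1] * !![a,b;c,d] * !![l,0;0,1] = !![a,l⁻¹*b;c*l,d] := by
    intro a b c d
    simp only [Matrix.mul_fin_two]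
    ext i j
    fin_cases i <;> fin_cases j <;> simp
    field_simp
  apply Concl.of_conj _ _ h1
  have G2 := G.conj _ _ h1 h2
  simp only [h3, mul_zero, zero_mul] at G2 ⊢
  exact C G2

theorem core (w e p q g h k h' k' : ℂ) (hw : w^2 = w-1)
    (G : Good !![w,0;0,1-w] !![g,h;k,1-g] !![e,p;q,1-e] !![g,h';k',1-g]) :
    Concl !![w,0;0,1-w] !![g,h;k,1-g] !![e,p;q,1-e] !![g,h';k',1-g] := by
  have d2 := G.d2
  have d4 := G.d4
  have U := G.U
  rw [Matrix.det_fin_two_of] at d2 d4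
  simp only [Matrix.mul_fin_two, Matrix.trace_fin_two_of] at U
  have hhk : h*k = h'*k' := by linear_combination d4-d2
  have hU : p*(k'-k) = q*(h-h') := by linear_combination U
  by_cases hp : p = 0
  · have hh : h ≠ 0 := by
      rintro rfl
      subst hp
      refine G.I ![0,1] (by simp) (1-w) (1-g) (1-e) ?_ ?_ ?_ <;> ext i <;> fin_cases i <;> simp
    by_cases hq : q = 0
    · have hk : k ≠ 0 := by
        rintro rfl
        subst hq
        refine G.I ![1,0] (by simp) w g e ?_ ?_ ?_ <;> ext i <;> fin_cases i <;> simp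
      have hk0 : h*k ≠ 0 := mul_ne_zero hh hk
      have hh' : h' ≠ 0 := by
        rintro rfl
        apply hk0; rw [hhk]; simp
      obtain ⟨l, hl⟩ := IsAlgClosed.exists_eq_mul_self (h'/k)
      have hl0 : l ≠ 0 := by
        rintro rfl
        apply hh'
        field_simp at hl
        simpa using hl
      subst hp hq
      apply coreScale _ _ _ _ _ _ _ _ _ l hl0 _ G
      have e1 : l⁻¹*h' = k*l := by field_simp; field_simp at hl; linear_combination hl
      have e2 : k'*l = l⁻¹*h := by
        field_simp; field_simp at hl
        apply mul_left_cancel₀ hk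
        linear_combination (-k')*hl - hhk
      rw [e1, e2, mul_zero, zero_mul]
      exact coreA _ _ _ _ _ _ hw
    · have e1 : h = h' := by
        rw [hp, zero_mul] at hU
        have := (mul_eq_zero.1 hU.symm).resolve_left hq
        linear_combination this
      subst e1
      have e2 : k = k' := mul_left_cancel₀ hh hhk
      subst e2
      exact coreC _ _ _ _ _ _ _ hw G
  · by_cases hq : q = 0
    · have hk : k ≠ 0 := by
        rintro rfl
        subst hq
        refine G.I ![1,0] (by simp) w g e ?_ ?_ ?_ <;> ext i <;> fin_cases i <;> simp
      have e1 : k = k' := by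
        rw [hq, zero_mul] at hU
        have := (mul_eq_zero.1 hU).resolve_left hp
        linear_combination -this
      subst e1
      have e2 : h = h' := mul_right_cancel₀ hk hhk
      subst e2
      exact coreC _ _ _ _ _ _ _ hw G
    · obtain ⟨l, hl⟩ := IsAlgClosed.exists_eq_mul_self (p/q)
      have hl0 : l ≠ 0 := by
        rintro rfl
        apply hp
        field_simp at hl
        simpa using hl
      apply coreScale _ _ _ _ _ _ _ _ _ l hl0 _ G
      have e1 : l⁻¹*p = q*l := by field_simp; field_simp at hl; linear_combination hl
      have e2 : k'*l - k*l = l⁻¹*h - l⁻¹*h' := by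
        apply mul_left_cancel₀ (mul_ne_zero hq hl0)
        have : l⁻¹*l=1 := inv_mul_cancel₀ hl0
        field_simp at hl
        linear_combination hU - (k'-k)*hl + q*(h'-h)*this
      have e3 : (l⁻¹*h)*(k*l) = (l⁻¹*h')*(k'*l) := by
        have : l⁻¹*l=1 := inv_mul_cancel₀ hl0
        linear_combination l⁻¹*l*hhk
      have e4 : (l⁻¹*h' - l⁻¹*h) * (l⁻¹*h' - k*l) = 0 := by
        linear_combination e3 + l⁻¹*h'*e2
      rw [e1]
      rcases mul_eq_zero.1 e4 with e5 | e5
      · have e6 : l⁻¹*h' = l⁻¹*h := by linear_combination e5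
        have e7 : k'*l = k*l := by linear_combination e2 - e5
        rw [e6, e7]
        exact coreC _ _ _ _ _ _ _ hw
      · have e6 : l⁻¹*h' = k*l := by linear_combination e5
        have e7 : k'*l = l⁻¹*h := by linear_combination e2 - e5
        rw [e6, e7]
        exact coreA _ _ _ _ _ _ hw

theorem mat_form (A : Matrix (Fin 2) (Fin 2) ℂ) (h : A.trace = 1) :
    ∃ a b c, A = !![a,b;c,1-a] := by
  refine ⟨A 0 0, A 0 1, A 1 0, ?_⟩
  rw [Matrix.trace_fin_two] at h
  conv_lhs => rw [Matrix.eta_fin_two A]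
  rw [← h]; congr; simp

theorem core2 (w : ℂ) (y z u : Matrix (Fin 2) (Fin 2) ℂ) (hw : w^2 = w-1)
    (G : Good !![w,0;0,1-w] y z u) : Concl !![w,0;0,1-w] y z u := by
  obtain ⟨g, h, k, rfl⟩ := mat_form y G.t2
  obtain ⟨e, p, q, rfl⟩ := mat_form z G.t3
  obtain ⟨g', h', k', rfl⟩ := mat_form u G.t4
  have T := G.T
  simp only [Matrix.mul_fin_two, Matrix.trace_fin_two_of] at T
  have hg : g = g' := by
    have : 2*w-1 ≠ 0 := by
      intro h0
      have h3 : (3:ℂ) = 0 := by linear_combination 4*hw - (2*w-1)*h0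
      norm_num at h3
    apply mul_left_cancel₀ this
    linear_combination -T
  subst hg
  exact core _ _ _ _ _ _ _ _ _ hw G

theorem key_s13 (x y z u : Matrix (Fin 2) (Fin 2) ℂ) (G : Good x y z u) : Concl x y z u := by
  obtain ⟨p, q, r, rfl⟩ := mat_form x G.t1
  have d1 := G.d1
  rw [Matrix.det_fin_two_of] at d1
  have : ∃ (w : ℂ) (P Q : Matrix (Fin 2) (Fin 2) ℂ), w^2=w-1 ∧ P*Q=1 ∧ 
      !![p,q;r,1-p] * P = P * !![w,0;0,1-w] := by
    by_cases hq : q = 0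
    · subst hq
      have hw : p^2=p-1 := by linear_combination -d1
      have h0 : 2*p-1 ≠ 0 := by
        intro h0
        have h3 : (3:ℂ) = 0 := by linear_combination 4*hw - (2*p-1)*h0
        norm_num at h3
      refine ⟨p, !![2*p-1,0;r,1], (!![2*p-1,0;r,1])⁻¹, hw, Matrix.mul_nonsing_inv _ ?_, ?_⟩
      · rw [Matrix.det_fin_two_of]; simpa using h0
      · simp only [Matrix.mul_fin_two]
        ext i j
        fin_cases i <;> fin_cases j <;> simp <;> ring
    · obtain ⟨s, hs⟩ := IsAlgClosed.exists_eq_mul_self (-3 : ℂ)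
      obtain ⟨w, rfl⟩ : ∃ w, s = 2*w-1 := ⟨(s+1)/2, by ring⟩
      have hw : w^2=w-1 := by linear_combination -hs/4
      have h0 : 2*w-1 ≠ 0 := by
        intro h0
        have h3 : (3:ℂ) = 0 := by linear_combination 4*hw - (2*w-1)*h0
        norm_num at h3
      refine ⟨w, !![q,q;w-p,1-w-p], (!![q,q;w-p,1-w-p])⁻¹, hw, Matrix.mul_nonsing_inv _ ?_, ?_⟩
      · rw [Matrix.det_fin_two_of, isUnit_iff_ne_zero]
        have := mul_ne_zero hq h0
        intro h1; apply this; linear_combination -h1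
      · simp only [Matrix.mul_fin_two]
        ext i j
        fin_cases i <;> fin_cases j <;> simp
        · ring
        · ring
        · linear_combination -hw - d1
        · linear_combination -hw - d1
  obtain ⟨w, P, Q, hw, h1, h2⟩ := this
  have h1' : Q * P = 1 := mul_eq_one_comm.1 h1
  apply Concl.of_conj _ _ h1
  have G2 := G.conj _ _ h1 h1'
  have e : Q * !![p,q;r,1-p] * P = !![w,0;0,1-w] := by
    rw [mul_assoc, h2, ← mul_assoc, h1', one_mul]
  rw [e] at G2 ⊢
  exact core2 _ _ _ _ hw G2

theorem sl_inv (t : ℂ) (ht : t ^ 2 = 1) (x : Matrix.SpecialLinearGroup (Fin 2) ℂ)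
    (hx : (x : Matrix (Fin 2) (Fin 2) ℂ).trace = t) :
    1 - t • (x : Matrix (Fin 2) (Fin 2) ℂ)
      = t • ((x⁻¹ : Matrix.SpecialLinearGroup (Fin 2) ℂ) : Matrix (Fin 2) (Fin 2) ℂ) := by
  rw [Matrix.SpecialLinearGroup.coe_inv, Matrix.adjugate_fin_two]
  rw [Matrix.trace_fin_two] at hx
  ext i j
  fin_cases i <;> fin_cases j <;> simp
  · linear_combination -ht - t * hx
  · linear_combination -ht - t * hx

theorem smul_ev (t a : ℂ) (ht : t ^ 2 = 1) (x : Matrix (Fin 2) (Fin 2) ℂ) (v : Fin 2 → ℂ)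
    (h : (t • x).mulVec v = a • v) : x.mulVec v = (t * a) • v := by
  rw [mul_smul, ← h, Matrix.smul_mulVec, smul_smul, ← sq, ht, one_smul]

theorem irr3 (t : ℂ) (ht : t ^ 2 = 1) (x y z : Matrix (Fin 2) (Fin 2) ℂ)
    (h : IsIrreducibleFamily ![x, y, z]) (v : Fin 2 → ℂ) (hv : v ≠ 0) (a b c : ℂ)
    (ha : (t • x).mulVec v = a • v) (hb : (t • y).mulVec v = b • v)
    (hc : (t • z).mulVec v = c • v) : False := by
  apply h
  refine ⟨v, hv, ?_⟩
  intro i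
  fin_cases i
  · exact ⟨_, smul_ev t a ht x v ha⟩
  · exact ⟨_, smul_ev t b ht y v hb⟩
  · exact ⟨_, smul_ev t c ht z v hc⟩

theorem smul_tr (t : ℂ) (ht : t ^ 2 = 1) (x y : Matrix (Fin 2) (Fin 2) ℂ) :
    ((t • x) * (t • y)).trace = (x * y).trace := by
  rw [smul_mul_smul_comm, ← sq, ht, one_smul]

theorem mkGood (t : ℂ) (ht : t ^ 2 = 1) (x y z u : Matrix.SpecialLinearGroup (Fin 2) ℂ)
    (hx : (x : Matrix (Fin 2) (Fin 2) ℂ).trace = t) (hy : (y : Matrix (Fin 2) (Fin 2) ℂ).trace = t)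
    (hz : (z : Matrix (Fin 2) (Fin 2) ℂ).trace = t) (hu : (u : Matrix (Fin 2) (Fin 2) ℂ).trace = t)
    (R : x * y * x⁻¹ * u * x = y * z * y⁻¹ * x * y)
    (S : y * z * y⁻¹ * x * y = u * x * u⁻¹ * z * u)
    (T : ((x : Matrix (Fin 2) (Fin 2) ℂ) * u).trace = ((x : Matrix (Fin 2) (Fin 2) ℂ) * y).trace)
    (U : ((z : Matrix (Fin 2) (Fin 2) ℂ) * u).trace = ((z : Matrix (Fin 2) (Fin 2) ℂ) * y).trace)
    (I : ∀ v : Fin 2 → ℂ, v ≠ 0 → ∀ a b c : ℂ,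
      (t • (x : Matrix (Fin 2) (Fin 2) ℂ)).mulVec v = a • v →
      (t • (y : Matrix (Fin 2) (Fin 2) ℂ)).mulVec v = b • v →
      (t • (z : Matrix (Fin 2) (Fin 2) ℂ)).mulVec v = c • v → False)
    (J : ∀ v : Fin 2 → ℂ, v ≠ 0 → ∀ a b c : ℂ,
      (t • (x : Matrix (Fin 2) (Fin 2) ℂ)).mulVec v = a • v →
      (t • (y : Matrix (Fin 2) (Fin 2) ℂ)).mulVec v = b • v →
      (t • (u : Matrix (Fin 2) (Fin 2) ℂ)).mulVec v = c • v → False) :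
    Good (t • (x : Matrix (Fin 2) (Fin 2) ℂ)) (t • (y : Matrix (Fin 2) (Fin 2) ℂ))
      (t • (z : Matrix (Fin 2) (Fin 2) ℂ)) (t • (u : Matrix (Fin 2) (Fin 2) ℂ)) := by
  have hd : ∀ s : Matrix.SpecialLinearGroup (Fin 2) ℂ,
      (t • (s : Matrix (Fin 2) (Fin 2) ℂ)).det = 1 := by
    intro s
    rw [Matrix.det_smul, s.det_coe]; simpa using ht
  have hT : ∀ s : Matrix.SpecialLinearGroup (Fin 2) ℂ, (s : Matrix (Fin 2) (Fin 2) ℂ).trace = t →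
      (t • (s : Matrix (Fin 2) (Fin 2) ℂ)).trace = 1 := by
    intro s hs
    rw [Matrix.trace_smul, hs, smul_eq_mul, ← sq, ht]
  have R' := congrArg (fun s : Matrix.SpecialLinearGroup (Fin 2) ℂ => (s : Matrix (Fin 2) (Fin 2) ℂ)) R
  have S' := congrArg (fun s : Matrix.SpecialLinearGroup (Fin 2) ℂ => (s : Matrix (Fin 2) (Fin 2) ℂ)) S
  simp only [Matrix.SpecialLinearGroup.coe_mul] at R' S'
  exact
    { d1 := hd x, d2 := hd y, d3 := hd z, d4 := hd u
      t1 := hT x hx, t2 := hT y hy, t3 := hT z hz, t4 := hT u hu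
      R := by
        rw [sl_inv t ht x hx, sl_inv t ht y hy]
        simp only [smul_mul_smul_comm, R']
      S := by
        rw [sl_inv t ht y hy, sl_inv t ht u hu]
        simp only [smul_mul_smul_comm, S']
      T := by rw [smul_tr t ht, smul_tr t ht, T]
      U := by rw [smul_tr t ht, smul_tr t ht, U]
      I := I
      J := J }

/-- Under the trace equations of 8₁₈ with all triples irreducible,
`tr(xᵢxᵢ₊₁) ≠ 1`, `tr(x₁x₃) ≠ tr(x₂x₄)`, `tr(x₁x₄) = tr(x₁x₂)` and
`tr(x₃x₄) = tr(x₂x₃)`, one has `t² ≠ 1`. -/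
theorem stmt13 (t : ℂ) (x₁ x₂ x₃ x₄ : SL2)
    (hx₁ : ((x₁ : 𝕄)).trace = t) (hx₂ : ((x₂ : 𝕄)).trace = t)
    (hx₃ : ((x₃ : 𝕄)).trace = t) (hx₄ : ((x₄ : 𝕄)).trace = t)
    (hr₁₂ : x₁ * x₂ * x₁⁻¹ * x₄ * x₁ = x₂ * x₃ * x₂⁻¹ * x₁ * x₂)
    (hr₂₃ : x₂ * x₃ * x₂⁻¹ * x₁ * x₂ = x₃ * x₄ * x₃⁻¹ * x₂ * x₃)
    (hr₃₄ : x₃ * x₄ * x₃⁻¹ * x₂ * x₃ = x₄ * x₁ * x₄⁻¹ * x₃ * x₄)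
    (hirr₁₂₃ : IsIrreducibleFamily ![(x₁ : 𝕄), (x₂ : 𝕄), (x₃ : 𝕄)])
    (hirr₁₂₄ : IsIrreducibleFamily ![(x₁ : 𝕄), (x₂ : 𝕄), (x₄ : 𝕄)])
    (hirr₁₃₄ : IsIrreducibleFamily ![(x₁ : 𝕄), (x₃ : 𝕄), (x₄ : 𝕄)])
    (hirr₂₃₄ : IsIrreducibleFamily ![(x₂ : 𝕄), (x₃ : 𝕄), (x₄ : 𝕄)])
    (ht₁₂ : ((x₁ * x₂ : SL2) : 𝕄).trace ≠ 1) (ht₂₃ : ((x₂ * x₃ : SL2) : 𝕄).trace ≠ 1)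
    (ht₃₄ : ((x₃ * x₄ : SL2) : 𝕄).trace ≠ 1) (ht₄₁ : ((x₄ * x₁ : SL2) : 𝕄).trace ≠ 1)
    (h : ((x₁ * x₃ : SL2) : 𝕄).trace ≠ ((x₂ * x₄ : SL2) : 𝕄).trace)
    (h14 : ((x₁ * x₄ : SL2) : 𝕄).trace = ((x₁ * x₂ : SL2) : 𝕄).trace)
    (h34 : ((x₃ * x₄ : SL2) : 𝕄).trace = ((x₂ * x₃ : SL2) : 𝕄).trace) :
    t ^ 2 ≠ 1 := by
  intro ht
  simp only [Matrix.SpecialLinearGroup.coe_mul] at ht₁₂ ht₂₃ ht₃₄ ht₄₁ h h14 h34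
  have cm : ∀ a b : Matrix (Fin 2) (Fin 2) ℂ, (a * b).trace = (b * a).trace :=
    fun a b => Matrix.trace_mul_comm a b
  have h34' : ((x₃ : Matrix (Fin 2) (Fin 2) ℂ) * x₄).trace
      = ((x₃ : Matrix (Fin 2) (Fin 2) ℂ) * x₂).trace := by rw [h34, cm]
  have G1 := mkGood t ht x₁ x₂ x₃ x₄ hx₁ hx₂ hx₃ hx₄ hr₁₂ (hr₂₃.trans hr₃₄) h14 h34'
    (irr3 t ht _ _ _ hirr₁₂₃) (irr3 t ht _ _ _ hirr₁₂₄)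
  have G2 := mkGood t ht x₃ x₄ x₁ x₂ hx₃ hx₄ hx₁ hx₂ hr₃₄ (hr₂₃.trans hr₃₄).symm h34'.symm h14.symm
    (fun v hv a b c ha hb hc => irr3 t ht _ _ _ hirr₁₃₄ v hv c a b hc ha hb)
    (fun v hv a b c ha hb hc => irr3 t ht _ _ _ hirr₂₃₄ v hv c a b hc ha hb)
  have K1 := key_s13 _ _ _ _ G1
  have K2 := key_s13 _ _ _ _ G2
  unfold Concl at K1 K2
  simp only [smul_tr t ht] at K1 K2
  rw [cm (x₃ : Matrix (Fin 2) (Fin 2) ℂ) x₁, cm (x₄ : Matrix (Fin 2) (Fin 2) ℂ) x₂, h14, h34'] at K2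
  rw [h34'] at ht₃₄
  obtain ⟨p1, p2⟩ := K1 ht₁₂ h
  obtain ⟨q1, q2⟩ := K2 ht₃₄ h
  generalize ((x₁ : Matrix (Fin 2) (Fin 2) ℂ) * x₂).trace = a at *
  generalize ((x₃ : Matrix (Fin 2) (Fin 2) ℂ) * x₂).trace = b at *
  have hne : a - b ≠ 0 := by
    intro h0
    apply h
    rw [h0, zero_mul] at p1
    linear_combination -p1
  have hab : a + b = 2 := by
    apply mul_left_cancel₀ hne
    linear_combination p1 - q1
  have pa := p2 hab
  have pb := q2 (by rw [add_comm]; exact hab)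
  apply ht₁₂
  linear_combination (pa - pb - (a - b) * hab) / 4 + hab / 2
end
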